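/- arXiv:2506.12740 — 4 statements merged into one kernel-verified Lean document; each statement's English description precedes it below -/
import Mathlib

section
/- Let G be a connected finite simple graph of order n ≥ 9 that is not isomorphic to F_n. Then d(G) ≤ h(n), where h(n) = 2^{n−1} + (n+9)·2^{(n−7)/2} if n is odd and h(n) = 2^{n−1} + (n+12)·2^{(n−8)/2} if n is even; equality holds if and only if G is isomorphic to U_n or to T_n, where U_n = K_3 ∗ (⌊(n−3)/2⌋ K_2 ∪ ((n+1) mod 2) K_1), T_n = K_1 ∗ (2K_1 ∪ ((n−3)/2)K_2) if n is odd, and T_n = K_1 ∗ (3K_1 ∪ ((n−4)/2)K_2) if n is even. -/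
open SimpleGraph

/-- `S` is a dissociation set of `G`: every vertex of `S` has at most one neighbor in `S`. -/
def IsDissociation {V : Type*} (G : SimpleGraph V) (S : Set V) : Prop :=
  ∀ v ∈ S, (G.neighborSet v ∩ S).Subsingleton

/-- `d(G)`: the number of dissociation sets of `G`. -/
noncomputable def dissocNum {V : Type*} (G : SimpleGraph V) : ℕ :=
  Nat.card {S : Set V // IsDissociation G S}

/-- `K_{r+1} ∗ (K_{s₀+1} ∪ ⋯ ∪ K_{sₜ+1})`: the hub `Sum.inl 0` of the complete graph
`K_{r+1}` is joined to the vertex `0` of each complete component. -/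
def starGraph (r : ℕ) (s : List ℕ) :
    SimpleGraph (Fin (r + 1) ⊕ (Σ i : Fin s.length, Fin (s.get i + 1))) where
  Adj x y := x ≠ y ∧
    (Sum.elim (fun _ => (none : Option (Fin s.length))) (fun p => some p.1) x =
        Sum.elim (fun _ => (none : Option (Fin s.length))) (fun p => some p.1) y ∨
      (x = Sum.inl 0 ∧ ∃ i, y = Sum.inr ⟨i, 0⟩) ∨
      (y = Sum.inl 0 ∧ ∃ i, x = Sum.inr ⟨i, 0⟩))
  symm := by
    constructor
    rintro x y ⟨h1, h2⟩
    refine ⟨h1.symm, ?_⟩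
    rcases h2 with h | h | h
    · exact Or.inl h.symm
    · exact Or.inr (Or.inr h)
    · exact Or.inr (Or.inl h)
  loopless := ⟨fun x h => h.1 rfl⟩

/-- `h(n) = 2^{n−1} + (n+9)·2^{(n−7)/2}` for odd `n` and
`h(n) = 2^{n−1} + (n+12)·2^{(n−8)/2}` for even `n`. -/
def hBound (n : ℕ) : ℕ :=
  if Odd n then 2 ^ (n - 1) + (n + 9) * 2 ^ ((n - 7) / 2)
  else 2 ^ (n - 1) + (n + 12) * 2 ^ ((n - 8) / 2)

/-- `G ≅ F_n`, where `F_n = K₁ ∗ ((n−1)/2)K₂` if `n` is odd and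
`F_n = K₂ ∗ ((n−2)/2)K₂` if `n` is even. -/
def IsFGraph (n : ℕ) {V : Type*} (G : SimpleGraph V) : Prop :=
  if Odd n then Nonempty (G ≃g starGraph 0 (List.replicate ((n - 1) / 2) 1))
  else Nonempty (G ≃g starGraph 1 (List.replicate ((n - 2) / 2) 1))

/-- `G ≅ T_n`, where `T_n = K₁ ∗ (2K₁ ∪ ((n−3)/2)K₂)` if `n` is odd and
`T_n = K₁ ∗ (3K₁ ∪ ((n−4)/2)K₂)` if `n` is even. -/
def IsTGraph (n : ℕ) {V : Type*} (G : SimpleGraph V) : Prop :=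
  if Odd n then
    Nonempty (G ≃g starGraph 0 (List.replicate 2 0 ++ List.replicate ((n - 3) / 2) 1))
  else
    Nonempty (G ≃g starGraph 0 (List.replicate 3 0 ++ List.replicate ((n - 4) / 2) 1))

/-- `G ≅ U_n`, where `U_n = K₃ ∗ (⌊(n−3)/2⌋K₂ ∪ ((n+1) mod 2)K₁)`. -/
def IsUGraph (n : ℕ) {V : Type*} (G : SimpleGraph V) : Prop :=
  Nonempty (G ≃g starGraph 2
    (List.replicate ((n - 3) / 2) 1 ++ List.replicate ((n + 1) % 2) 0))

/-! ### Connected vertex sets and spiders -/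

section Structure

variable {V : Type*} [DecidableEq V] {G : SimpleGraph V}

/-- `X` is spanned by a subtree of `G` rooted at `v`. -/
inductive RootedSpan (G : SimpleGraph V) : V → Finset V → Prop
  | single (v : V) : RootedSpan G v {v}
  | join {v w : V} {X Y : Finset V} : RootedSpan G v X → RootedSpan G w Y → Disjoint X Y →
      G.Adj v w → RootedSpan G v (X ∪ Y)

namespace RootedSpan

theorem root_mem {v : V} {X : Finset V} (h : RootedSpan G v X) : v ∈ X := by
  induction h with
  | single v => simp
  | join _ _ _ _ ih _ => exact Finset.mem_union_left _ ih

theorem attach {v x w : V} {X Y : Finset V} (h : RootedSpan G v X) (hx : x ∈ X)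
    (hY : RootedSpan G w Y) (hd : Disjoint X Y) (ha : G.Adj x w) :
    RootedSpan G v (X ∪ Y) := by
  induction h with
  | single v =>
    obtain rfl := Finset.mem_singleton.1 hx
    exact .join (.single _) hY hd ha
  | @join v w' X₁ X₂ h₁ h₂ hd' ha' ih₁ ih₂ =>
    rw [Finset.disjoint_union_left] at hd
    rcases Finset.mem_union.1 hx with hx | hx
    · rw [Finset.union_right_comm]
      exact .join (ih₁ hx hd.1) h₂ (Finset.disjoint_union_left.2 ⟨hd', hd.2.symm⟩) ha'
    · rw [Finset.union_assoc]
      exact .join h₁ (ih₂ hx hd.2) (Finset.disjoint_union_right.2 ⟨hd', hd.1⟩) ha'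

theorem reroot {v x : V} {X : Finset V} (h : RootedSpan G v X) (hx : x ∈ X) :
    RootedSpan G x X := by
  induction h with
  | single v =>
    obtain rfl := Finset.mem_singleton.1 hx
    exact .single _
  | join h₁ h₂ hd ha ih₁ ih₂ =>
    rcases Finset.mem_union.1 hx with hx | hx
    · exact (ih₁ hx).attach h₁.root_mem h₂ hd ha
    · rw [Finset.union_comm]
      exact (ih₂ hx).attach h₂.root_mem h₁ hd.symm ha.symm

theorem exists_adj {v : V} {X : Finset V} (h : RootedSpan G v X) (hX : X ≠ {v}) :
    ∃ w ∈ X, G.Adj v w := by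
  cases h with
  | single => exact absurd rfl hX
  | join h₁ h₂ hd ha => exact ⟨_, Finset.mem_union_right _ h₂.root_mem, ha⟩

end RootedSpan

theorem SimpleGraph.Connected.rootedSpan_univ [Fintype V] (hc : G.Connected) (v : V) :
    RootedSpan G v Finset.univ := by
  obtain ⟨X, hX, hmax⟩ := Set.Finite.exists_maximalFor Finset.card
    {X : Finset V | RootedSpan G v X} (Set.toFinite _) ⟨{v}, .single v⟩
  by_cases hu : X = Finset.univ
  · exact hu ▸ hX
  exfalso
  have hne : ∃ y, y ∉ X := by
    by_contra! h
    exact hu (Finset.eq_univ_iff_forall.2 h)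
  obtain ⟨y, hy⟩ := hne
  obtain ⟨p⟩ := hc.preconnected v y
  obtain ⟨d, -, hd₁, hd₂⟩ := p.exists_boundary_dart (X : Set V) hX.root_mem hy
  have hdis : Disjoint X {d.snd} := Finset.disjoint_singleton_right.2 hd₂
  have h2 : RootedSpan G v (X ∪ {d.snd}) := hX.attach hd₁ (.single _) hdis d.adj
  have h3 := hmax h2 (Finset.card_le_card Finset.subset_union_left)
  rw [Finset.card_union_of_disjoint hdis] at h3
  simp at h3

/-- `X` splits into two connected parts with at least three vertices each. -/
def HasSplit (G : SimpleGraph V) (X : Finset V) : Prop :=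
  ∃ v w Y Z, RootedSpan G v Y ∧ RootedSpan G w Z ∧ Disjoint Y Z ∧ G.Adj v w ∧ Y ∪ Z = X ∧
    3 ≤ Y.card ∧ Y.card ≤ Z.card

theorem HasSplit.mk' {v w : V} {Y Z : Finset V} (hY : RootedSpan G v Y) (hZ : RootedSpan G w Z)
    (hd : Disjoint Y Z) (ha : G.Adj v w) (h₁ : 3 ≤ Y.card) (h₂ : 3 ≤ Z.card) :
    HasSplit G (Y ∪ Z) := by
  rcases le_total Y.card Z.card with h | h
  · exact ⟨v, w, Y, Z, hY, hZ, hd, ha, rfl, h₁, h⟩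
  · exact ⟨w, v, Z, Y, hZ, hY, hd.symm, ha.symm, Finset.union_comm _ _, h₂, h⟩

/-- `X` is spanned by a tree in which all branches at the vertex `u` have at most two
vertices. -/
inductive Spider (G : SimpleGraph V) (u : V) : Finset V → Prop
  | single : Spider G u {u}
  | join {w : V} {X Y : Finset V} : Spider G u X → RootedSpan G w Y → Y.card ≤ 2 →
      Disjoint X Y → G.Adj u w → Spider G u (X ∪ Y)

namespace Spider

theorem rootedSpan {u : V} {X : Finset V} (h : Spider G u X) : RootedSpan G u X := by
  induction h with
  | single => exact .single u
  | join _ hY _ hd ha ih => exact .join ih hY hd ha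

theorem exists_branch {u x : V} {X : Finset V} (h : Spider G u X) (hx : x ∈ X) (hxu : x ≠ u) :
    ∃ w L, x ∈ L ∧ RootedSpan G w L ∧ L.card ≤ 2 ∧ G.Adj u w ∧ L ⊆ X ∧ u ∉ L ∧
      Spider G u (X \ L) := by
  induction h with
  | single => exact absurd (Finset.mem_singleton.1 hx) hxu
  | @join w X Y h hY hc hd ha ih =>
    by_cases hxY : x ∈ Y
    · refine ⟨w, Y, hxY, hY, hc, ha, Finset.subset_union_right,
        Finset.disjoint_left.1 hd h.rootedSpan.root_mem, ?_⟩
      rwa [Finset.union_sdiff_right, Finset.sdiff_eq_self_of_disjoint hd]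
    · obtain ⟨w', L, h1, h2, h3, h4, h5, h6, h7⟩ :=
        ih ((Finset.mem_union.1 hx).resolve_right hxY)
      refine ⟨w', L, h1, h2, h3, h4, h5.trans Finset.subset_union_left, h6, ?_⟩
      rw [Finset.union_sdiff_distrib,
        Finset.sdiff_eq_self_of_disjoint (hd.symm.mono_right h5)]
      exact .join h7 hY hc (hd.mono_left Finset.sdiff_subset) ha

end Spider

theorem RootedSpan.hasSplit_or_spider_aux {v : V} {X : Finset V} (h : RootedSpan G v X) :
    ∀ Z, Spider G v Z → X ∩ Z = {v} → HasSplit G (X ∪ Z) ∨ ∃ u, Spider G u (X ∪ Z) := by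
  induction h with
  | single v =>
    intro Z hZ _
    right
    refine ⟨v, ?_⟩
    rwa [Finset.union_eq_right.2 (Finset.singleton_subset_iff.2 hZ.rootedSpan.root_mem)]
  | @join v w X Y h₁ h₂ hd ha ih₁ ih₂ =>
    intro Z hZ hi
    have hvY : v ∉ Y := Finset.disjoint_left.1 hd h₁.root_mem
    have hZY : Disjoint Z Y := by
      rw [Finset.disjoint_left]
      intro x hxZ hxY
      have : x ∈ (X ∪ Y) ∩ Z := by simp [hxZ, hxY]
      rw [hi, Finset.mem_singleton] at this
      exact hvY (this ▸ hxY)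
    have hXZ : X ∩ Z = {v} := by
      apply Finset.Subset.antisymm
      · rw [← hi]
        exact Finset.inter_subset_inter_right Finset.subset_union_left
      · simp [h₁.root_mem, hZ.rootedSpan.root_mem]
    have hXZ' : RootedSpan G v (X ∪ Z) := by
      clear ih₁ ih₂ h₂ ha hvY hd hi hZY
      induction hZ with
      | single => rwa [Finset.union_eq_left.2 (Finset.singleton_subset_iff.2 h₁.root_mem)]
      | @join w Z L hZ hL _ hdL haL ih =>
        have hXL : Disjoint X L := by
          rw [Finset.disjoint_left]
          intro x hxX hxL
          have : x ∈ X ∩ (Z ∪ L) := by simp [hxX, hxL]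
          rw [hXZ, Finset.mem_singleton] at this
          exact Finset.disjoint_left.1 hdL hZ.rootedSpan.root_mem (this ▸ hxL)
        have hXZ2 : X ∩ Z = {v} := by
          apply Finset.Subset.antisymm
          · rw [← hXZ]
            exact Finset.inter_subset_inter_left Finset.subset_union_left
          · simp [h₁.root_mem, hZ.rootedSpan.root_mem]
        rw [← Finset.union_assoc]
        exact .join (ih hXZ2) hL (Finset.disjoint_union_left.2 ⟨hXL, hdL⟩) haL
    have hd' : Disjoint (X ∪ Z) Y := Finset.disjoint_union_left.2 ⟨hd, hZY⟩
    rcases le_or_gt Y.card 2 with hY | hY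
    · rw [Finset.union_assoc, Finset.union_comm Y Z]
      refine ih₁ (Z ∪ Y) (.join hZ h₂ hY hZY ha) ?_
      rw [Finset.inter_union_distrib_left, hXZ, Finset.disjoint_iff_inter_eq_empty.1 hd,
        Finset.union_empty]
    · rw [Finset.union_right_comm]
      rcases le_or_gt (X ∪ Z).card 2 with hc | hc
      · have hw : w ∉ X ∪ Z := fun h => Finset.disjoint_left.1 hd' h h₂.root_mem
        have h3 : Y ∪ ({w} ∪ (X ∪ Z)) = X ∪ Z ∪ Y := by
          ext x
          have := h₂.root_mem
          simp only [Finset.mem_union, Finset.mem_singleton]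
          constructor
          · rintro (h | rfl | h | h) <;> tauto
          · tauto
        rw [← h3]
        refine ih₂ _ (.join .single hXZ' hc (Finset.disjoint_singleton_left.2 hw) ha.symm) ?_
        rw [Finset.inter_union_distrib_left, Finset.disjoint_iff_inter_eq_empty.1 hd'.symm,
          Finset.union_empty]
        simpa using h₂.root_mem
      · exact Or.inl (HasSplit.mk' hXZ' h₂ hd' ha hc hY)

theorem RootedSpan.hasSplit_or_spider {v : V} {X : Finset V} (h : RootedSpan G v X) :
    HasSplit G X ∨ ∃ u, Spider G u X := by
  have := h.hasSplit_or_spider_aux {v} .single (by simpa using h.root_mem)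
  rwa [Finset.union_eq_left.2 (Finset.singleton_subset_iff.2 h.root_mem)] at this

/-- Deleting `u` leaves a graph of maximum degree at most one. -/
def IsHub (G : SimpleGraph V) (u : V) : Prop :=
  ∀ x y z, x ≠ u → y ≠ u → z ≠ u → G.Adj x y → G.Adj x z → y = z

theorem Spider.hasSplit_of_sdiff {u v : V} {X W : Finset V} (h : Spider G u (X \ W))
    (hW : RootedSpan G v W) (ha : G.Adj u v) (hWX : W ⊆ X) (hX : 7 ≤ X.card)
    (h3 : 3 ≤ W.card) (h4 : W.card ≤ 4) : HasSplit G X := by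
  have hc := Finset.card_sdiff_add_card_eq_card hWX
  rw [← Finset.sdiff_union_of_subset hWX]
  exact HasSplit.mk' h.rootedSpan hW Finset.sdiff_disjoint ha (by omega) h3

theorem Spider.hasSplit_or_isHub [Fintype V] {u : V} (h : Spider G u Finset.univ)
    (h7 : 7 ≤ Fintype.card V) : HasSplit G Finset.univ ∨ IsHub G u := by
  rw [or_iff_not_imp_right]
  intro hh
  unfold IsHub at hh
  push Not at hh
  obtain ⟨x, y, z, hx, hy, hz, hxy, hxz, hyz⟩ := hh
  have key : ∀ {x y : V} {w : V} {L : Finset V}, x ≠ u → y ≠ u → G.Adj x y → x ∈ L → y ∉ L →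
      RootedSpan G w L → L.card ≤ 2 → G.Adj u w → Spider G u (Finset.univ \ L) →
      HasSplit G Finset.univ ∨ (L.card = 1 ∧ ∃ w' L', y ∈ L' ∧ RootedSpan G w' L' ∧
        L'.card = 1 ∧ G.Adj u w' ∧ Spider G u (Finset.univ \ (L ∪ L')) ∧ Disjoint L L') := by
    intro x y w L hx hy hxy hxL hyL hL hLc ha hS
    obtain ⟨w', L', h1, h2, h3, h4, h5, h6, h7'⟩ := hS.exists_branch (by simpa using hyL) hy
    have hd : Disjoint L L' := (Finset.disjoint_sdiff).mono_right h5
    rw [sdiff_sdiff_left, Finset.sup_eq_union] at h7'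
    have hcard := Finset.card_union_of_disjoint hd
    have hp1 : 0 < L.card := Finset.card_pos.2 ⟨x, hxL⟩
    have hp2 : 0 < L'.card := Finset.card_pos.2 ⟨y, h1⟩
    by_cases hc : 3 ≤ (L ∪ L').card
    · left
      refine h7'.hasSplit_of_sdiff (v := w) ?_ ha (Finset.subset_univ _)
        (by simpa using h7) hc (by omega)
      exact hL.attach hxL (h2.reroot h1) hd hxy
    · right
      exact ⟨by omega, w', L', h1, h2, by omega, h4, h7', hd⟩
  obtain ⟨w, L, h1, h2, h3, h4, h5, h6, h7'⟩ := h.exists_branch (Finset.mem_univ x) hx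
  by_cases hyL : y ∈ L
  · have hzL : z ∉ L := by
      intro hzL
      have : ({x, y, z} : Finset V) ⊆ L := by
        intro t ht
        simp only [Finset.mem_insert, Finset.mem_singleton] at ht
        rcases ht with rfl | rfl | rfl <;> assumption
      have := Finset.card_le_card this
      rw [Finset.card_eq_three.2 ⟨x, y, z, hxy.ne, hxz.ne, hyz, rfl⟩] at this
      omega
    rcases key hx hz hxz h1 hzL h2 h3 h4 h7' with h | ⟨h, -⟩
    · exact h
    · have := Finset.card_le_one.1 h.le x h1 y hyL
      exact absurd this hxy.ne
  · rcases key hx hy hxy h1 hyL h2 h3 h4 h7' with h | ⟨hL1, w', L', g1, g2, g3, g4, g5, g6⟩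
    · exact h
    · have hzL : z ∉ L := fun hzL => hxz.ne (Finset.card_le_one.1 hL1.le x h1 z hzL)
      have hzL' : z ∉ L' := fun hzL => hyz (Finset.card_le_one.1 g3.le y g1 z hzL)
      obtain ⟨w'', L'', k1, k2, k3, k4, k5, k6, k7⟩ :=
        g5.exists_branch (x := z) (by simp [hzL, hzL']) hz
      have hd : Disjoint (L ∪ L') L'' := (Finset.disjoint_sdiff).mono_right k5
      rw [sdiff_sdiff_left, Finset.sup_eq_union] at k7
      have hc1 := Finset.card_union_of_disjoint g6
      have hc2 := Finset.card_union_of_disjoint hd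
      have hp : 0 < L''.card := Finset.card_pos.2 ⟨z, k1⟩
      refine k7.hasSplit_of_sdiff (v := w) ?_ h4 (Finset.subset_univ _) (by simpa using h7)
        (by omega) (by omega)
      exact (h2.attach h1 (g2.reroot g1) g6 hxy).attach (Finset.mem_union_left _ h1)
        (k2.reroot k1) hd hxz

end Structure

/-! ### Numerical estimates -/

section Numerics

/-- The number of dissociation sets containing the hub of a graph on `n` vertices, `b` of which
are not adjacent to the hub. -/
def hubExcess (n b : ℕ) : ℕ :=
  2 ^ b + b * 2 ^ (b - 1) + (n - 1 - 2 * b) * 2 ^ b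

/-- The largest number of dissociation sets of a connected graph on `n` vertices. -/
def maxDissoc (n : ℕ) : ℕ :=
  2 ^ (n - 1) + hubExcess n ((n - 1) / 2)

theorem hubExcess_add (b s : ℕ) :
    2 * hubExcess (2 * b + 1 + s) b = (b + 2 * s + 2) * 2 ^ b := by
  unfold hubExcess
  rw [show 2 * b + 1 + s - 1 - 2 * b = s by omega]
  rcases b with _ | b
  · simp; ring
  · rw [Nat.add_sub_cancel, pow_succ]; ring

theorem hubExcess_le_succ {n b : ℕ} (h : 2 * (b + 1) + 1 ≤ n) :
    hubExcess n b ≤ hubExcess n (b + 1) := by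
  obtain ⟨s, rfl⟩ := Nat.exists_eq_add_of_le h
  have h1 := hubExcess_add (b + 1) s
  have h2 := hubExcess_add b (s + 2)
  rw [show 2 * b + 1 + (s + 2) = 2 * (b + 1) + 1 + s by ring] at h2
  rw [pow_succ] at h1
  nlinarith [Nat.zero_le (2 ^ b), Nat.zero_le (b * 2 ^ b), Nat.zero_le (s * 2 ^ b)]

theorem hubExcess_lt_succ {n b : ℕ} (h : 2 * (b + 1) + 1 ≤ n) (hn : 4 ≤ n) :
    hubExcess n b < hubExcess n (b + 1) := by
  obtain ⟨s, rfl⟩ := Nat.exists_eq_add_of_le h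
  have h1 := hubExcess_add (b + 1) s
  have h2 := hubExcess_add b (s + 2)
  rw [show 2 * b + 1 + (s + 2) = 2 * (b + 1) + 1 + s by ring] at h2
  rw [pow_succ] at h1
  have : 0 < (b + 2 * s) * 2 ^ b := Nat.mul_pos (by omega) (by positivity)
  nlinarith

theorem hubExcess_mono {n b c : ℕ} (hbc : b ≤ c) (h : 2 * c + 1 ≤ n) :
    hubExcess n b ≤ hubExcess n c := by
  induction c, hbc using Nat.le_induction with
  | base => exact le_rfl
  | succ c _ ih => exact (ih (by omega)).trans (hubExcess_le_succ h)

theorem hubExcess_pos (n b : ℕ) : 0 < hubExcess n b := by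
  unfold hubExcess
  positivity

theorem maxDissoc_succ_le {n : ℕ} (hn : 1 ≤ n) : maxDissoc (n + 1) ≤ 2 * maxDissoc n := by
  unfold maxDissoc
  obtain ⟨m, rfl | rfl⟩ : ∃ m, n = 2 * m + 1 ∨ n = 2 * m + 2 := ⟨(n - 1) / 2, by omega⟩
  · have h1 := hubExcess_add m 0
    have h2 := hubExcess_add m 1
    rw [show (2 * m + 1 + 1 - 1) / 2 = m by omega, show (2 * m + 1 - 1) / 2 = m by omega]
    rw [show 2 * m + 1 + 1 - 1 = 2 * m + 1 - 1 + 1 by omega, pow_succ]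
    simp only [add_zero] at h1
    nlinarith [Nat.zero_le (m * 2 ^ m)]
  · have h1 := hubExcess_add m 1
    have h2 := hubExcess_add (m + 1) 0
    rw [show (2 * m + 2 + 1 - 1) / 2 = m + 1 by omega, show (2 * m + 2 - 1) / 2 = m by omega]
    rw [show 2 * m + 2 + 1 - 1 = 2 * m + 2 - 1 + 1 by omega, pow_succ]
    rw [show 2 * (m + 1) + 1 + 0 = 2 * m + 2 + 1 by ring, pow_succ] at h2
    rw [show 2 * m + 1 + 1 = 2 * m + 2 by ring] at h1
    nlinarith [Nat.zero_le (m * 2 ^ m)]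

theorem maxDissoc_le_two_pow_mul {k : ℕ} (hk : 1 ≤ k) (m : ℕ) :
    maxDissoc (k + m) ≤ 2 ^ m * maxDissoc k := by
  induction m with
  | zero => simp
  | succ m ih =>
    calc maxDissoc (k + m + 1) ≤ 2 * maxDissoc (k + m) := maxDissoc_succ_le (by omega)
      _ ≤ 2 * (2 ^ m * maxDissoc k) := by gcongr
      _ = _ := by ring

theorem maxDissoc_div_le {k n : ℕ} (hk : 1 ≤ k) (hkn : k ≤ n) :
    (maxDissoc n : ℚ) ≤ maxDissoc k / 2 ^ k * 2 ^ n := by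
  obtain ⟨m, rfl⟩ := Nat.exists_eq_add_of_le hkn
  have h : (maxDissoc (k + m) : ℚ) ≤ 2 ^ m * maxDissoc k := by
    exact_mod_cast maxDissoc_le_two_pow_mul hk m
  calc (maxDissoc (k + m) : ℚ) ≤ 2 ^ m * maxDissoc k := h
    _ = _ := by rw [pow_add]; field_simp

theorem hBound_eq {n : ℕ} (hn : 9 ≤ n) :
    hBound n = 2 ^ (n - 1) + hubExcess n ((n - 1) / 2 - 1) := by
  unfold hBound
  split_ifs with h
  · obtain ⟨m, rfl⟩ := h
    obtain ⟨k, rfl⟩ : ∃ k, m = k + 4 := ⟨m - 4, by omega⟩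
    have h1 := hubExcess_add (k + 3) 2
    rw [show (2 * (k + 4) + 1 - 1) / 2 - 1 = k + 3 by omega,
      show (2 * (k + 4) + 1 - 7) / 2 = k + 1 by omega]
    rw [show 2 * (k + 3) + 1 + 2 = 2 * (k + 4) + 1 by ring] at h1
    rw [pow_add] at h1
    rw [pow_add 2 k 1]
    nlinarith
  · obtain ⟨m, rfl⟩ := Nat.not_odd_iff_even.1 h
    obtain ⟨k, rfl⟩ : ∃ k, m = k + 5 := ⟨m - 5, by omega⟩
    have h1 := hubExcess_add (k + 3) 3
    rw [show (k + 5 + (k + 5) - 1) / 2 - 1 = k + 3 by omega,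
      show (k + 5 + (k + 5) - 8) / 2 = k + 1 by omega]
    rw [show 2 * (k + 3) + 1 + 3 = k + 5 + (k + 5) by ring] at h1
    rw [pow_add] at h1
    rw [pow_add 2 k 1]
    nlinarith

/-- Bounds on the number `t` of dissociation sets of a connected graph on `n` vertices, the
number `a` of those avoiding a given vertex, and the number `b` of those in which that vertex is
isolated. -/
def CountBounds (n t a b : ℕ) : Prop :=
  t ≤ maxDissoc n ∧ a ≤ 2 ^ (n - 1) ∧ ((a ≤ maxDissoc (n - 1) ∧ b ≤ 2 ^ (n - 2)) ∨
    (b ≤ 2 ^ (n - 3) ∧ (n = 7 → a ≤ 52 ∨ b ≤ 8)))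

theorem glue_mono {v t₁ a₁ b₁ t₂ a₂ b₂ : ℕ}
    (hv : v + a₁ * a₂ ≤ a₁ * t₂ + t₁ * a₂ + b₁ * b₂) {T₁ A₁ B₁ T₂ A₂ B₂ : ℚ}
    (ht₁ : (t₁ : ℚ) ≤ T₁) (ha₁ : (a₁ : ℚ) ≤ A₁) (hb₁ : (b₁ : ℚ) ≤ B₁) (hA₁ : A₁ ≤ T₁)
    (ht₂ : (t₂ : ℚ) ≤ T₂) (ha₂ : (a₂ : ℚ) ≤ A₂) (hb₂ : (b₂ : ℚ) ≤ B₂) (hA₂ : A₂ ≤ T₂) :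
    (v : ℚ) ≤ A₁ * T₂ + T₁ * A₂ - A₁ * A₂ + B₁ * B₂ := by
  have hv' : (v : ℚ) + a₁ * a₂ ≤ a₁ * t₂ + t₁ * a₂ + b₁ * b₂ := by exact_mod_cast hv
  have h₁ : (0 : ℚ) ≤ a₁ := by positivity
  have h₂ : (0 : ℚ) ≤ a₂ := by positivity
  have h₃ : (0 : ℚ) ≤ b₁ := by positivity
  have h₄ : (b₁ : ℚ) * b₂ ≤ B₁ * B₂ :=
    mul_le_mul hb₁ hb₂ (by positivity) (h₃.trans hb₁)
  nlinarith [mul_nonneg h₁ (sub_nonneg.2 ht₂), mul_nonneg (sub_nonneg.2 ht₁) h₂,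
    mul_nonneg (sub_nonneg.2 ha₁) (sub_nonneg.2 (ha₂.trans hA₂)),
    mul_nonneg (sub_nonneg.2 ha₂) (sub_nonneg.2 hA₁)]

/-- The extremal pairs `(a, b)` allowed by `CountBounds n`. -/
def extremalPairs (n : ℕ) : List (ℕ × ℕ) :=
  (maxDissoc (n - 1), 2 ^ (n - 2)) ::
    if n = 7 then [(52, 16), (64, 8)] else [(2 ^ (n - 1), 2 ^ (n - 3))]

theorem CountBounds.exists_mem_extremalPairs {n t a b : ℕ} (h : CountBounds n t a b) :
    ∃ p ∈ extremalPairs n, a ≤ p.1 ∧ b ≤ p.2 := by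
  obtain ⟨-, ha, ⟨ha', hb⟩ | ⟨hb, h7⟩⟩ := h
  · exact ⟨_, List.mem_cons_self, ha', hb⟩
  · by_cases hn : n = 7
    · subst hn
      rcases h7 rfl with h | h
      · exact ⟨(52, 16), by simp [extremalPairs], h, hb⟩
      · exact ⟨(64, 8), by simp [extremalPairs], ha, h⟩
    · exact ⟨(2 ^ (n - 1), 2 ^ (n - 3)), by simp [extremalPairs, hn], ha, hb⟩

set_option synthInstance.maxHeartbeats 200000 in
set_option synthInstance.maxSize 1000 in
theorem extremalPairs_glue_le : ∀ n < 15, ∀ n₁ < 8, 3 ≤ n₁ → 2 * n₁ ≤ n →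
    ∀ p ∈ extremalPairs n₁, ∀ q ∈ extremalPairs (n - n₁),
      p.1 ≤ maxDissoc n₁ ∧ q.1 ≤ maxDissoc (n - n₁) ∧
      p.1 * maxDissoc (n - n₁) + maxDissoc n₁ * q.1 + p.2 * q.2 ≤ p.1 * q.1 + maxDissoc n ∧
      (9 ≤ n → p.1 * maxDissoc (n - n₁) + maxDissoc n₁ * q.1 + p.2 * q.2 <
        p.1 * q.1 + hBound n) := by
  decide +kernel

theorem two_pow_le_maxDissoc (n : ℕ) : 2 ^ (n - 1) ≤ maxDissoc n :=
  Nat.le_add_right _ _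

theorem glue_le_of_fifteen_le {n₁ n₂ v t₁ a₁ b₁ t₂ a₂ b₂ : ℕ}
    (hv : v + a₁ * a₂ ≤ a₁ * t₂ + t₁ * a₂ + b₁ * b₂) (h₁ : CountBounds n₁ t₁ a₁ b₁)
    (h₂ : CountBounds n₂ t₂ a₂ b₂) (h3 : 3 ≤ n₁) (h12 : n₁ ≤ n₂) (hn : 15 ≤ n₁ + n₂) :
    v ≤ 2 ^ (n₁ + n₂ - 1) := by
  have half : ∀ {n k : ℕ}, k ≤ n → ((2 ^ (n - k) : ℕ) : ℚ) = 2 ^ n / 2 ^ k := by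
    intro n k hk
    rw [eq_div_iff (by positivity)]
    norm_cast
    rw [← pow_add, Nat.sub_add_cancel hk]
  obtain ⟨ht₁, ha₁, hb₁⟩ := h₁
  obtain ⟨ht₂, ha₂, hb₂⟩ := h₂
  rw [← Nat.cast_le (α := ℚ)] at ha₁ ha₂ ht₁ ht₂ ⊢
  rw [half (by omega)] at ha₁ ha₂ ⊢
  have e₁ := maxDissoc_div_le (k := 3) (n := n₁) (by norm_num) h3
  have e₂ := maxDissoc_div_le (k := 8) (n := n₂) (by norm_num) (by omega)
  have P₁ : (0 : ℚ) < 2 ^ n₁ := by positivity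
  have P₂ : (0 : ℚ) < 2 ^ n₂ := by positivity
  have P : (0 : ℚ) < 2 ^ n₁ * 2 ^ n₂ := by positivity
  rw [show maxDissoc 3 = 7 by decide] at e₁
  rw [show maxDissoc 8 = 156 by decide] at e₂
  rw [pow_add]
  have two : ∀ {n b : ℕ}, 3 ≤ n → b ≤ 2 ^ (n - 2) → (b : ℚ) ≤ 2 ^ n / 2 ^ 2 := by
    intro n b hn hb
    rw [← half (by omega)]
    exact_mod_cast hb
  have three : ∀ {n b : ℕ}, 3 ≤ n → b ≤ 2 ^ (n - 3) → (b : ℚ) ≤ 2 ^ n / 2 ^ 3 := by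
    intro n b hn hb
    rw [← half (by omega)]
    exact_mod_cast hb
  have weak : ∀ {n b : ℕ}, b ≤ 2 ^ (n - 3) → b ≤ 2 ^ (n - 2) := fun h =>
    h.trans (Nat.pow_le_pow_right (by norm_num) (by omega))
  have hb₁' : b₁ ≤ 2 ^ (n₁ - 2) := by rcases hb₁ with h | h; exacts [h.2, weak h.1]
  have hb₂' : b₂ ≤ 2 ^ (n₂ - 2) := by rcases hb₂ with h | h; exacts [h.2, weak h.1]
  have mixed : ∀ {B₁ B₂ : ℚ}, (b₁ : ℚ) ≤ B₁ → (b₂ : ℚ) ≤ B₂ →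
      B₁ * B₂ ≤ 2 ^ n₁ * 2 ^ n₂ / 32 → (v : ℚ) ≤ 2 ^ n₁ * 2 ^ n₂ / 2 ^ 1 := by
    intro B₁ B₂ hB₁ hB₂ hB
    obtain rfl | h4 : n₁ = 3 ∨ 4 ≤ n₁ := by omega
    · have e := maxDissoc_div_le (k := 10) (n := n₂) (by norm_num) (by omega)
      rw [show maxDissoc 10 = 576 by decide] at e
      have := glue_mono hv (ht₁.trans e₁) ha₁ hB₁ (by linarith) (ht₂.trans e) ha₂ hB₂
        (by linarith)
      norm_num at this hB ⊢
      linarith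
    · have e := maxDissoc_div_le (k := 4) (n := n₁) (by norm_num) h4
      rw [show maxDissoc 4 = 13 by decide] at e
      have := glue_mono hv (ht₁.trans e) ha₁ hB₁ (by linarith) (ht₂.trans e₂) ha₂ hB₂
        (by linarith)
      norm_num at this hB ⊢
      nlinarith
  rcases hb₁ with hb₁ | hb₁
  · rcases hb₂ with hb₂ | hb₂
    · have e := maxDissoc_div_le (k := 7) (n := n₂ - 1) (by norm_num) (by omega)
      rw [show maxDissoc 7 = 84 by decide] at e
      have h2 : (2 : ℚ) ^ (n₂ - 1) = 2 ^ n₂ / 2 := by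
        have := half (n := n₂) (k := 1) (by omega)
        push_cast at this
        linarith
      rw [h2] at e
      have ha : (a₂ : ℚ) ≤ maxDissoc (n₂ - 1) := by exact_mod_cast hb₂.1
      have := glue_mono hv (ht₁.trans e₁) ha₁ (two h3 hb₁') (by linarith) (ht₂.trans e₂)
        (ha.trans e) (two (by omega) hb₂') (by norm_num; linarith)
      norm_num at this ⊢
      nlinarith
    · exact mixed (two h3 hb₁') (three (by omega) hb₂.1) (by nlinarith)
  · exact mixed (three h3 hb₁.1) (two (by omega) hb₂') (by nlinarith)

theorem two_pow_lt_hBound {n : ℕ} (hn : 9 ≤ n) : 2 ^ (n - 1) < hBound n := by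
  rw [hBound_eq hn]
  have := hubExcess_pos n ((n - 1) / 2 - 1)
  omega

theorem CountBounds.glue_le {n₁ n₂ v t₁ a₁ b₁ t₂ a₂ b₂ : ℕ}
    (hv : v + a₁ * a₂ ≤ a₁ * t₂ + t₁ * a₂ + b₁ * b₂) (h₁ : CountBounds n₁ t₁ a₁ b₁)
    (h₂ : CountBounds n₂ t₂ a₂ b₂) (h3 : 3 ≤ n₁) (h12 : n₁ ≤ n₂) :
    v ≤ maxDissoc (n₁ + n₂) ∧ (9 ≤ n₁ + n₂ → v < hBound (n₁ + n₂)) := by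
  rcases lt_or_ge (n₁ + n₂) 15 with hn | hn
  · obtain ⟨p, hp, hpa, hpb⟩ := h₁.exists_mem_extremalPairs
    obtain ⟨q, hq, hqa, hqb⟩ := h₂.exists_mem_extremalPairs
    have key := extremalPairs_glue_le (n₁ + n₂) hn n₁ (by omega) h3 (by omega) p hp q
      (by rwa [Nat.add_sub_cancel_left])
    rw [Nat.add_sub_cancel_left] at key
    obtain ⟨hp', hq', k1, k2⟩ := key
    have := glue_mono hv (Nat.cast_le.2 h₁.1) (Nat.cast_le.2 hpa) (Nat.cast_le.2 hpb)
      (Nat.cast_le.2 hp') (Nat.cast_le.2 h₂.1) (Nat.cast_le.2 hqa) (Nat.cast_le.2 hqb)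
      (Nat.cast_le.2 hq')
    have hv' : v + p.1 * q.1 ≤ p.1 * maxDissoc n₂ + maxDissoc n₁ * q.1 + p.2 * q.2 := by
      have : (v : ℚ) + p.1 * q.1 ≤
          p.1 * maxDissoc n₂ + maxDissoc n₁ * q.1 + p.2 * q.2 := by linarith
      exact_mod_cast this
    exact ⟨by omega, fun h9 => by have := k2 h9; omega⟩
  · have := glue_le_of_fifteen_le hv h₁ h₂ h3 h12 hn
    exact ⟨this.trans (two_pow_le_maxDissoc _),
      fun h9 => this.trans_lt (two_pow_lt_hBound h9)⟩

end Numerics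
/-! ### Counting dissociation sets -/

section Counting

variable {V : Type*} {G : SimpleGraph V}

theorem IsDissociation.mono {S T : Set V} (hT : IsDissociation G T) (h : S ⊆ T) :
    IsDissociation G S :=
  fun v hv => (hT v (h hv)).anti (Set.inter_subset_inter_right _ h)

/-- The dissociation sets of `G` contained in `X`. -/
noncomputable def dissocSets (G : SimpleGraph V) (X : Finset V) : Finset (Finset V) :=
  open Classical in X.powerset.filter fun S => IsDissociation G (S : Set V)

theorem mem_dissocSets {X S : Finset V} :
    S ∈ dissocSets G X ↔ S ⊆ X ∧ IsDissociation G (S : Set V) := by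
  simp [dissocSets]

theorem dissocNum_eq_card [Fintype V] : dissocNum G = (dissocSets G Finset.univ).card := by
  rw [dissocNum, ← Fintype.card_coe, ← Nat.card_eq_fintype_card]
  exact Nat.card_congr (Equiv.subtypeEquiv Fintype.finsetEquivSet fun S => by
    simp [mem_dissocSets]).symm

theorem card_dissocSets_le (X : Finset V) : (dissocSets G X).card ≤ 2 ^ X.card := by
  rw [← Finset.card_powerset]
  exact Finset.card_le_card fun S hS => Finset.mem_powerset.2 (mem_dissocSets.1 hS).1

variable [DecidableEq V]

/-- The dissociation sets of `G` contained in `X` and containing `v`. -/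
noncomputable def dissocSetsThrough (G : SimpleGraph V) (v : V) (X : Finset V) :
    Finset (Finset V) :=
  (dissocSets G X).filter fun S => v ∈ S

/-- The dissociation sets of `G` contained in `X` in which `v` is an isolated vertex. -/
noncomputable def dissocSetsIsolated (G : SimpleGraph V) (v : V) (X : Finset V) :
    Finset (Finset V) :=
  open Classical in (dissocSetsThrough G v X).filter fun S => ∀ w ∈ S, ¬ G.Adj v w


theorem mem_dissocSetsThrough {v : V} {X S : Finset V} :
    S ∈ dissocSetsThrough G v X ↔ (S ⊆ X ∧ IsDissociation G (S : Set V)) ∧ v ∈ S := by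
  simp [dissocSetsThrough, mem_dissocSets]

theorem mem_dissocSetsIsolated {v : V} {X S : Finset V} :
    S ∈ dissocSetsIsolated G v X ↔
      ((S ⊆ X ∧ IsDissociation G (S : Set V)) ∧ v ∈ S) ∧ ∀ w ∈ S, ¬ G.Adj v w := by
  simp [dissocSetsIsolated, mem_dissocSetsThrough]

theorem card_dissocSets (G : SimpleGraph V) (v : V) (X : Finset V) :
    (dissocSets G X).card =
      (dissocSets G (X.erase v)).card + (dissocSetsThrough G v X).card := by
  rw [← Finset.card_filter_add_card_filter_not (s := dissocSets G X) (fun S => v ∉ S)]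
  congr 2
  · ext S
    simp only [Finset.mem_filter, mem_dissocSets, Finset.subset_erase]
    tauto
  · simp [dissocSetsThrough]

theorem card_le_mul_of_inter_mem {X Y : Finset V} {F A B : Finset (Finset V)}
    (hF : ∀ S ∈ F, S ⊆ X ∪ Y) (hA : ∀ S ∈ F, S ∩ X ∈ A) (hB : ∀ S ∈ F, S ∩ Y ∈ B) :
    F.card ≤ A.card * B.card := by
  rw [← Finset.card_product]
  refine Finset.card_le_card_of_injOn (fun S => (S ∩ X, S ∩ Y))
    (fun S hS => Finset.mem_product.2 ⟨hA S hS, hB S hS⟩) fun S hS T hT h => ?_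
  simp only [Prod.mk.injEq] at h
  rw [← Finset.inter_eq_left.2 (hF S hS), ← Finset.inter_eq_left.2 (hF T hT),
    Finset.inter_union_distrib_left, Finset.inter_union_distrib_left, h.1, h.2]

theorem IsDissociation.inter_mem_dissocSets {S : Finset V} (h : IsDissociation G (S : Set V))
    (X : Finset V) : S ∩ X ∈ dissocSets G X :=
  mem_dissocSets.2 ⟨Finset.inter_subset_right, h.mono (by simp)⟩

theorem card_dissocSets_union_le (X Y : Finset V) :
    (dissocSets G (X ∪ Y)).card ≤ (dissocSets G X).card * (dissocSets G Y).card :=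
  card_le_mul_of_inter_mem (fun _ hS => (mem_dissocSets.1 hS).1)
    (fun _ hS => (mem_dissocSets.1 hS).2.inter_mem_dissocSets X)
    (fun _ hS => (mem_dissocSets.1 hS).2.inter_mem_dissocSets Y)

theorem IsDissociation.inter_mem_dissocSets_erase {S : Finset V} {w : V}
    (h : IsDissociation G (S : Set V)) (X : Finset V) (hw : w ∉ S) :
    S ∩ X ∈ dissocSets G (X.erase w) :=
  mem_dissocSets.2 ⟨Finset.subset_erase.2 ⟨Finset.inter_subset_right,
    fun hh => hw (Finset.mem_inter.1 hh).1⟩, h.mono (by simp)⟩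

theorem card_dissocSets_erase_union_le {v : V} {X Y : Finset V} (hv : v ∈ X) (hd : Disjoint X Y) :
    (dissocSets G ((X ∪ Y).erase v)).card ≤
      (dissocSets G (X.erase v)).card * (dissocSets G Y).card := by
  rw [Finset.erase_union_distrib, Finset.erase_eq_of_notMem (Finset.disjoint_left.1 hd hv)]
  exact card_dissocSets_union_le _ _

theorem card_dissocSetsIsolated_union_le {v w : V} {X Y : Finset V} (hv : v ∈ X) (ha : G.Adj v w) :
    (dissocSetsIsolated G v (X ∪ Y)).card ≤
      (dissocSetsIsolated G v X).card * (dissocSets G (Y.erase w)).card := by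
  refine card_le_mul_of_inter_mem (fun _ hS => (mem_dissocSetsIsolated.1 hS).1.1.1)
    (fun S hS => ?_) (fun S hS => ?_)
  · obtain ⟨⟨⟨-, h2⟩, h3⟩, h4⟩ := mem_dissocSetsIsolated.1 hS
    exact mem_dissocSetsIsolated.2 ⟨⟨mem_dissocSets.1 (h2.inter_mem_dissocSets X),
      Finset.mem_inter.2 ⟨h3, hv⟩⟩, fun x hx => h4 x (Finset.mem_inter.1 hx).1⟩
  · obtain ⟨⟨⟨-, h2⟩, h3⟩, h4⟩ := mem_dissocSetsIsolated.1 hS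
    exact h2.inter_mem_dissocSets_erase Y fun hwS => h4 w hwS ha

theorem card_dissocSetsThrough_union_le {v w : V} {X Y : Finset V} (hv : v ∈ X) (hw : w ∈ Y)
    (hd : Disjoint X Y) (ha : G.Adj v w) :
    (dissocSetsThrough G v (X ∪ Y)).card ≤
      (dissocSetsThrough G v X).card * (dissocSets G (Y.erase w)).card +
        (dissocSetsIsolated G v X).card * (dissocSetsIsolated G w Y).card := by
  rw [← Finset.card_filter_add_card_filter_not (s := dissocSetsThrough G v (X ∪ Y))
    (fun S => w ∉ S)]
  have isolated : ∀ {S : Finset V} {v w : V} {X Y : Finset V}, v ∈ X → w ∈ Y → Disjoint X Y →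
      G.Adj v w → IsDissociation G (S : Set V) → v ∈ S → w ∈ S →
      S ∩ X ∈ dissocSetsIsolated G v X := by
    intro S v w X Y hv hw hd ha hS hvS hwS
    refine mem_dissocSetsIsolated.2 ⟨⟨mem_dissocSets.1 (hS.inter_mem_dissocSets X),
      Finset.mem_inter.2 ⟨hvS, hv⟩⟩, fun x hx hax => ?_⟩
    rw [Finset.mem_inter] at hx
    have := hS v hvS ⟨hax, hx.1⟩ ⟨ha, hwS⟩
    subst this
    exact Finset.disjoint_left.1 hd hx.2 hw
  refine Nat.add_le_add ?_ ?_
  · refine card_le_mul_of_inter_mem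
      (fun _ hS => (mem_dissocSetsThrough.1 (Finset.mem_filter.1 hS).1).1.1)
      (fun S hS => ?_) (fun S hS => ?_)
    · obtain ⟨h1, -⟩ := Finset.mem_filter.1 hS
      obtain ⟨⟨-, h2⟩, h3⟩ := mem_dissocSetsThrough.1 h1
      exact mem_dissocSetsThrough.2 ⟨mem_dissocSets.1 (h2.inter_mem_dissocSets X),
        Finset.mem_inter.2 ⟨h3, hv⟩⟩
    · obtain ⟨h1, hwS⟩ := Finset.mem_filter.1 hS
      obtain ⟨⟨-, h2⟩, h3⟩ := mem_dissocSetsThrough.1 h1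
      exact h2.inter_mem_dissocSets_erase Y hwS
  · refine card_le_mul_of_inter_mem
      (fun _ hS => (mem_dissocSetsThrough.1 (Finset.mem_filter.1 hS).1).1.1)
      (fun S hS => ?_) (fun S hS => ?_)
    all_goals
      obtain ⟨h1, hwS⟩ := Finset.mem_filter.1 hS
      rw [not_not] at hwS
      obtain ⟨⟨-, h2⟩, h3⟩ := mem_dissocSetsThrough.1 h1
    · exact isolated hv hw hd ha h2 h3 hwS
    · exact isolated hw hv hd.symm ha.symm h2 hwS h3

theorem card_dissocSets_union_add_le {v w : V} {X Y : Finset V} (hv : v ∈ X) (hw : w ∈ Y)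
    (hd : Disjoint X Y) (ha : G.Adj v w) :
    (dissocSets G (X ∪ Y)).card +
        (dissocSets G (X.erase v)).card * (dissocSets G (Y.erase w)).card ≤
      (dissocSets G (X.erase v)).card * (dissocSets G Y).card +
        (dissocSets G X).card * (dissocSets G (Y.erase w)).card +
        (dissocSetsIsolated G v X).card * (dissocSetsIsolated G w Y).card := by
  rw [card_dissocSets G v (X ∪ Y)]
  have h1 := card_dissocSets_erase_union_le (G := G) hv hd
  have h2 := card_dissocSetsThrough_union_le hv hw hd ha
  have h3 := card_dissocSets G v X
  rw [h3]
  linarith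

theorem card_dissocSetsIsolated_le {v : V} {X N : Finset V} (hv : v ∈ X) (hN : N ⊆ X)
    (ha : ∀ w ∈ N, G.Adj v w) :
    (dissocSetsIsolated G v X).card ≤ 2 ^ (X.card - (N.card + 1)) := by
  have hvN : v ∉ N := fun h => G.irrefl (ha v h)
  have hc : (X \ insert v N).card = X.card - (N.card + 1) := by
    rw [Finset.card_sdiff_of_subset (Finset.insert_subset hv hN),
      Finset.card_insert_of_notMem hvN]
  rw [← hc, ← Finset.card_powerset]
  refine Finset.card_le_card_of_injOn (fun S => S.erase v) (fun S hS => ?_)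
    fun S hS T hT h => ?_
  · obtain ⟨⟨⟨h1, -⟩, h3⟩, h4⟩ := mem_dissocSetsIsolated.1 hS
    simp only [Finset.coe_powerset, Set.mem_preimage, Set.mem_powerset_iff, Finset.coe_subset]
    intro x hx
    rw [Finset.mem_erase] at hx
    rw [Finset.mem_sdiff, Finset.mem_insert]
    exact ⟨h1 hx.2, fun h => h.elim hx.1 fun h => h4 x hx.2 (ha x h)⟩
  · have h3 := (mem_dissocSetsIsolated.1 hS).1.2
    have h3' := (mem_dissocSetsIsolated.1 hT).1.2
    rw [← Finset.insert_erase h3, ← Finset.insert_erase h3']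
    exact congrArg (insert v) h

theorem Spider.exists_card_le {u : V} {X : Finset V} (h : Spider G u X) :
    ∃ k, 2 * k + 1 ≤ X.card ∧ (dissocSetsIsolated G u X).card ≤ 2 ^ k ∧
      (dissocSetsThrough G u X).card ≤ hubExcess X.card k := by
  induction h with
  | single =>
    refine ⟨0, by simp, ?_, ?_⟩
    · have := card_dissocSetsIsolated_le (G := G) (v := u) (X := {u}) (N := ∅)
        (by simp) (by simp) (by simp)
      simpa using this
    · have h1 := card_dissocSets G u {u}
      have h2 := card_dissocSets_le (G := G) {u}
      have h3 : 0 < (dissocSets G (({u} : Finset V).erase u)).card := by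
        refine Finset.card_pos.2 ⟨∅, mem_dissocSets.2 ⟨by simp, ?_⟩⟩
        intro v hv
        simp at hv
      have h4 : hubExcess ({u} : Finset V).card 0 = 1 := by simp [hubExcess]
      rw [Finset.card_singleton] at h2
      omega
  | @join w X Y hX hY hc hd ha ih =>
    obtain ⟨k, h1, h2, h3⟩ := ih
    have hu := hX.rootedSpan.root_mem
    have hw := hY.root_mem
    have i1 := card_dissocSetsIsolated_union_le (Y := Y) hu ha
    have i2 := card_dissocSetsThrough_union_le hu hw hd ha
    have i3 := card_dissocSets_le (G := G) (Y.erase w)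
    rw [Finset.card_erase_of_mem hw] at i3
    have i4 : (dissocSetsIsolated G w Y).card ≤ 1 := by
      by_cases hY1 : Y = {w}
      · subst hY1
        simpa using card_dissocSetsIsolated_le (G := G) (v := w) (X := {w}) (N := ∅)
          (by simp) (by simp) (by simp)
      · obtain ⟨z, hz, haz⟩ := hY.exists_adj hY1
        have := card_dissocSetsIsolated_le (G := G) (v := w) (X := Y) (N := {z}) hw
          (by simpa using hz) (by simpa using haz)
        rwa [Finset.card_singleton, Nat.sub_eq_zero_of_le (by omega), pow_zero] at this
    have hp : 0 < Y.card := Finset.card_pos.2 ⟨w, hw⟩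
    rw [Finset.card_union_of_disjoint hd]
    obtain ⟨s, hs⟩ := Nat.exists_eq_add_of_le h1
    have e := hubExcess_add k s
    rw [← hs] at e
    obtain hY1 | hY2 : Y.card = 1 ∨ Y.card = 2 := by omega
    · have e' := hubExcess_add k (s + 1)
      rw [← add_assoc, ← hs] at e'
      rw [hY1] at i3 ⊢
      simp only [Nat.sub_self, pow_zero] at i3
      refine ⟨k, by omega, ?_, ?_⟩
      · calc _ ≤ _ := i1
          _ ≤ 2 ^ k * 1 := Nat.mul_le_mul h2 i3
          _ = _ := mul_one _
      · have : _ ≤ hubExcess X.card k * 1 + 2 ^ k * 1 :=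
          i2.trans (Nat.add_le_add (Nat.mul_le_mul h3 i3) (Nat.mul_le_mul h2 i4))
        nlinarith
    · have e' := hubExcess_add (k + 1) s
      rw [show 2 * (k + 1) + 1 + s = X.card + 2 by omega] at e'
      rw [hY2] at i3 ⊢
      simp only [Nat.add_one_sub_one, pow_one] at i3
      refine ⟨k + 1, by omega, ?_, ?_⟩
      · calc _ ≤ _ := i1
          _ ≤ 2 ^ k * 2 := Nat.mul_le_mul h2 i3
          _ = _ := (pow_succ _ _).symm
      · have : _ ≤ hubExcess X.card k * 2 + 2 ^ k * 1 :=
          i2.trans (Nat.add_le_add (Nat.mul_le_mul h3 i3) (Nat.mul_le_mul h2 i4))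
        rw [pow_succ] at e'
        nlinarith

theorem Spider.card_dissocSets_le_maxDissoc {u : V} {X : Finset V} (h : Spider G u X) :
    (dissocSets G X).card ≤ maxDissoc X.card := by
  obtain ⟨k, h1, -, h2⟩ := h.exists_card_le
  have h3 := card_dissocSets_le (G := G) (X.erase u)
  rw [Finset.card_erase_of_mem h.rootedSpan.root_mem] at h3
  rw [card_dissocSets G u X]
  exact Nat.add_le_add h3 (h2.trans (hubExcess_mono (by omega) (by omega)))

theorem maxDissoc_mul_le_fifty_two : ∀ i ≤ 5, 1 ≤ i → maxDissoc i * maxDissoc (6 - i) ≤ 52 := by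
  decide

theorem RootedSpan.countBounds {v : V} {X : Finset V} (h : RootedSpan G v X)
    (hX : 3 ≤ X.card)
    (ih : ∀ w Y, RootedSpan G w Y → Y.card ≤ X.card →
      (dissocSets G Y).card ≤ maxDissoc Y.card) :
    CountBounds X.card (dissocSets G X).card (dissocSets G (X.erase v)).card
      (dissocSetsIsolated G v X).card := by
  refine ⟨ih v X h le_rfl, ?_, ?_⟩
  · have := card_dissocSets_le (G := G) (X.erase v)
    rwa [Finset.card_erase_of_mem h.root_mem] at this
  have hiso : ∀ N : Finset V, N ⊆ X → (∀ w ∈ N, G.Adj v w) →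
      (dissocSetsIsolated G v X).card ≤ 2 ^ (X.card - (N.card + 1)) := fun N hN ha =>
    card_dissocSetsIsolated_le h.root_mem hN ha
  cases h with
  | single => simp at hX
  | @join _ w X₁ Y h₁ hY hd ha =>
    have hvY := Finset.disjoint_left.1 hd h₁.root_mem
    have hwX := Finset.disjoint_right.1 hd hY.root_mem
    by_cases h1 : X₁ = {v}
    · left
      subst h1
      have he : ({v} ∪ Y).erase v = Y := by
        rw [Finset.erase_union_distrib]; simp [Finset.erase_eq_of_notMem hvY]
      have hc : ({v} ∪ Y).card = Y.card + 1 := by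
        rw [Finset.card_union_of_disjoint hd, Finset.card_singleton, add_comm]
      rw [he]
      refine ⟨?_, ?_⟩
      · rw [hc]
        exact ih w Y hY (by omega)
      · simpa using hiso {w} (by simpa using Or.inr hY.root_mem) (by simpa using ha)
    · right
      obtain ⟨w', hw', ha'⟩ := h₁.exists_adj h1
      have hne : w ≠ w' := fun hh => hwX (hh ▸ hw')
      have hw : w ∈ X₁ ∪ Y := Finset.mem_union_right _ hY.root_mem
      refine ⟨?_, fun h7 => ?_⟩
      · have := hiso {w, w'} (by
          simp only [Finset.insert_subset_iff, Finset.singleton_subset_iff]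
          exact ⟨hw, Finset.mem_union_left _ hw'⟩) (by simp [ha, ha'])
        rwa [Finset.card_pair hne] at this
      · cases h₁ with
        | single => exact absurd rfl h1
        | @join _ w' X₂ Y' h₂ hY' hd' ha' =>
          have hvY' := Finset.disjoint_left.1 hd' h₂.root_mem
          have hwX' := Finset.disjoint_right.1 hd' hY'.root_mem
          by_cases h2 : X₂ = {v}
          · left
            subst h2
            have he : ({v} ∪ Y' ∪ Y).erase v = Y' ∪ Y := by
              rw [Finset.union_assoc, Finset.erase_union_distrib]
              rw [Finset.erase_eq_of_notMem (s := Y' ∪ Y) (by simp [hvY, hvY'])]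
              simp
            have hc : ({v} ∪ Y' ∪ Y).card = Y'.card + Y.card + 1 := by
              rw [Finset.card_union_of_disjoint hd, Finset.card_union_of_disjoint hd',
                Finset.card_singleton]
              ring
            have p1 : 0 < Y.card := Finset.card_pos.2 ⟨_, hY.root_mem⟩
            have p2 : 0 < Y'.card := Finset.card_pos.2 ⟨_, hY'.root_mem⟩
            rw [he]
            calc _ ≤ _ := card_dissocSets_union_le Y' Y
              _ ≤ maxDissoc Y'.card * maxDissoc Y.card :=
                Nat.mul_le_mul (ih _ _ hY' (by omega)) (ih _ _ hY (by omega))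
              _ = maxDissoc Y'.card * maxDissoc (6 - Y'.card) := by
                rw [show Y.card = 6 - Y'.card by omega]
              _ ≤ 52 := maxDissoc_mul_le_fifty_two _ (by omega) (by omega)
          · right
            obtain ⟨w'', hw'', ha''⟩ := h₂.exists_adj h2
            have n1 : w ≠ w' := by
              rintro rfl
              exact hwX (Finset.mem_union_right _ hY'.root_mem)
            have n2 : w ≠ w'' := by
              rintro rfl
              exact hwX (Finset.mem_union_left _ hw'')
            have n3 : w' ≠ w'' := by
              rintro rfl
              exact hwX' hw''
            have := hiso {w, w', w''} (by
              simp only [Finset.insert_subset_iff, Finset.singleton_subset_iff,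
                Finset.mem_union]
              exact ⟨Or.inr hY.root_mem, Or.inl (Or.inr hY'.root_mem), Or.inl (Or.inl hw'')⟩)
              (by simp [ha, ha', ha''])
            rw [Finset.card_eq_three.2 ⟨w, w', w'', n1, n2, n3, rfl⟩, h7] at this
            exact this

theorem HasSplit.card_dissocSets_le {X : Finset V} (h : HasSplit G X)
    (ih : ∀ w Y, RootedSpan G w Y → Y.card < X.card →
      (dissocSets G Y).card ≤ maxDissoc Y.card) :
    (dissocSets G X).card ≤ maxDissoc X.card ∧
      (9 ≤ X.card → (dissocSets G X).card < hBound X.card) := by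
  obtain ⟨v, w, Y, Z, hY, hZ, hd, ha, rfl, h3, hYZ⟩ := h
  have hc := Finset.card_union_of_disjoint hd
  have key := CountBounds.glue_le
    (card_dissocSets_union_add_le hY.root_mem hZ.root_mem hd ha)
    (hY.countBounds h3 fun w' Y' h' hc' => ih w' Y' h' (by omega))
    (hZ.countBounds (by omega) fun w' Y' h' hc' => ih w' Y' h' (by omega)) h3 hYZ
  rwa [← hc] at key

theorem RootedSpan.card_dissocSets_le_maxDissoc {v : V} {X : Finset V}
    (h : RootedSpan G v X) : (dissocSets G X).card ≤ maxDissoc X.card := by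
  induction hn : X.card using Nat.strong_induction_on generalizing v X with
  | _ n ih =>
    subst hn
    rcases h.hasSplit_or_spider with hs | ⟨u, hu⟩
    · exact (hs.card_dissocSets_le fun w Y hY hc => ih _ hc hY rfl).1
    · exact hu.card_dissocSets_le_maxDissoc

end Counting

/-! ### Graphs with a hub -/

section Hub

variable {V : Type*} [Fintype V] {G : SimpleGraph V} {u : V}

/-- The neighbors of `u`. -/
noncomputable def nearSet (G : SimpleGraph V) (u : V) : Finset V :=
  open Classical in Finset.univ.filter fun x => G.Adj u x

/-- The vertices other than `u` not adjacent to `u`. -/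
noncomputable def farSet (G : SimpleGraph V) (u : V) : Finset V :=
  open Classical in Finset.univ.filter fun x => x ≠ u ∧ ¬ G.Adj u x

/-- The neighbors of `u` with a neighbor at distance two from `u`. -/
noncomputable def matchedSet (G : SimpleGraph V) (u : V) : Finset V :=
  open Classical in (nearSet G u).filter fun x => ∃ y ∈ farSet G u, G.Adj x y

theorem mem_nearSet {x : V} : x ∈ nearSet G u ↔ G.Adj u x := by simp [nearSet]

theorem mem_farSet {x : V} : x ∈ farSet G u ↔ x ≠ u ∧ ¬ G.Adj u x := by simp [farSet]

theorem mem_matchedSet {x : V} :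
    x ∈ matchedSet G u ↔ G.Adj u x ∧ ∃ y ∈ farSet G u, G.Adj x y := by
  simp [matchedSet, mem_nearSet]

theorem card_nearSet_add_card_farSet [DecidableEq V] (G : SimpleGraph V) (u : V) :
    (nearSet G u).card + (farSet G u).card + 1 = Fintype.card V := by
  have hd : Disjoint (nearSet G u) (farSet G u) := by
    rw [Finset.disjoint_left]
    intro x h1 h2
    exact (mem_farSet.1 h2).2 (mem_nearSet.1 h1)
  have hu : u ∉ nearSet G u ∪ farSet G u := by
    simp [mem_nearSet, mem_farSet]
  rw [← Finset.card_union_of_disjoint hd, ← Finset.card_insert_of_notMem hu, ← Finset.card_univ]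
  congr 1
  ext x
  simp only [Finset.mem_insert, Finset.mem_union, mem_nearSet, mem_farSet, Finset.mem_univ]
  tauto

namespace IsHub

theorem exists_adj_of_mem_farSet (hu : IsHub G u) (hc : G.Connected) {x : V}
    (hx : x ∈ farSet G u) : ∃ y ∈ matchedSet G u, G.Adj x y := by
  obtain ⟨hxu, hux⟩ := mem_farSet.1 hx
  suffices h : ∃ y, G.Adj u y ∧ G.Adj x y by
    obtain ⟨y, h1, h2⟩ := h
    exact ⟨y, mem_matchedSet.2 ⟨h1, x, hx, h2.symm⟩, h2⟩
  obtain ⟨p⟩ := hc.preconnected x u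
  obtain ⟨d, -, hd1, hd2⟩ := p.exists_boundary_dart {x} rfl (by simpa using hxu.symm)
  rw [Set.mem_singleton_iff] at hd1
  have hxy : G.Adj x d.snd := hd1 ▸ d.adj
  have hyu : d.snd ≠ u := fun h => hux (h ▸ hxy.symm)
  by_cases huy : G.Adj u d.snd
  · exact ⟨_, huy, hxy⟩
  exfalso
  obtain ⟨d', -, h1, h2⟩ := p.exists_boundary_dart {x, d.snd} (by simp)
    (by simp [hxu.symm, hyu.symm])
  simp only [Set.mem_insert_iff, Set.mem_singleton_iff, not_or] at h1 h2
  have had := d'.adj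
  rcases h1 with h1 | h1
  · rw [h1] at had
    have : d'.snd ≠ u := fun h => hux (h ▸ had.symm)
    exact h2.2 (hu x _ _ hxu this hyu had hxy)
  · rw [h1] at had
    have : d'.snd ≠ u := fun h => huy (h ▸ had.symm)
    exact h2.1 (hu _ _ _ hyu this hxu had hxy.symm)

theorem eq_of_adj_far (hu : IsHub G u) {x y z : V} (hx : x ∈ farSet G u) (hy : y ≠ u)
    (hz : z ≠ u) (hxy : G.Adj x y) (hxz : G.Adj x z) : y = z :=
  hu x y z (mem_farSet.1 hx).1 hy hz hxy hxz

theorem card_matchedSet (hu : IsHub G u) (hc : G.Connected) :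
    (matchedSet G u).card = (farSet G u).card := by
  symm
  choose f hf1 hf2 using fun x (hx : x ∈ farSet G u) => hu.exists_adj_of_mem_farSet hc hx
  refine Finset.card_bij f hf1 (fun x hx y hy h => ?_) fun y hy => ?_
  · exact hu (f x hx) x y (mem_matchedSet.1 (hf1 x hx)).1.ne' (mem_farSet.1 hx).1
      (mem_farSet.1 hy).1 (hf2 x hx).symm (h ▸ (hf2 y hy).symm)
  · obtain ⟨h1, x, hx, hxy⟩ := mem_matchedSet.1 hy
    exact ⟨x, hx, hu.eq_of_adj_far hx (mem_matchedSet.1 (hf1 x hx)).1.ne' h1.ne' (hf2 x hx)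
      hxy.symm⟩

theorem dissocSets_univ_erase [DecidableEq V] (hu : IsHub G u) :
    dissocSets G (Finset.univ.erase u) = (Finset.univ.erase u).powerset := by
  ext S
  rw [mem_dissocSets, Finset.mem_powerset, and_iff_left_iff_imp]
  intro hS x hx y hy z hz
  have ne : ∀ {y}, y ∈ S → y ≠ u := fun hy => (Finset.mem_erase.1 (hS hy)).1
  exact hu x y z (ne hx) (ne hy.2) (ne hz.2) hy.1 hz.1

theorem dissocSetsThrough_univ [DecidableEq V] [DecidableRel G.Adj] (hu : IsHub G u) :
    dissocSetsThrough G u Finset.univ = (farSet G u).powerset.image (insert u) ∪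
      (nearSet G u).biUnion fun x =>
        ((farSet G u).filter fun y => ¬ G.Adj x y).powerset.image
          fun S => insert u (insert x S) := by
  ext S
  rw [mem_dissocSetsThrough]
  simp only [Finset.mem_union, Finset.mem_image, Finset.mem_powerset, Finset.mem_biUnion,
    mem_nearSet]
  constructor
  · rintro ⟨⟨-, hS⟩, huS⟩
    by_cases hN : ∃ x ∈ S, G.Adj u x
    · right
      obtain ⟨x, hx, hux⟩ := hN
      refine ⟨x, hux, (S.erase u).erase x, fun y hy => ?_, ?_⟩
      · simp only [Finset.mem_erase] at hy
        rw [Finset.mem_filter, mem_farSet]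
        refine ⟨⟨hy.2.1, fun huy => hy.1 (hS u huS ⟨huy, hy.2.2⟩ ⟨hux, hx⟩)⟩, fun hxy => ?_⟩
        exact hy.2.1 (hS x hx ⟨hxy, hy.2.2⟩ ⟨hux.symm, huS⟩)
      · rw [Finset.insert_erase (Finset.mem_erase.2 ⟨hux.ne', hx⟩), Finset.insert_erase huS]
    · left
      push Not at hN
      refine ⟨S.erase u, fun y hy => ?_, Finset.insert_erase huS⟩
      rw [Finset.mem_erase] at hy
      exact mem_farSet.2 ⟨hy.1, hN y hy.2⟩
  · rintro (⟨T, hT, rfl⟩ | ⟨x, hux, T, hT, rfl⟩)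
    · refine ⟨⟨Finset.subset_univ _, ?_⟩, Finset.mem_insert_self _ _⟩
      have far : ∀ {v}, v ∈ insert u T → ¬ G.Adj u v := by
        intro v hv
        rcases Finset.mem_insert.1 hv with rfl | hv
        · exact G.irrefl
        · exact (mem_farSet.1 (hT hv)).2
      rintro v hv y ⟨hvy, hy⟩ z ⟨hvz, hz⟩
      rw [Finset.mem_coe] at hv hy hz
      have hvu : v ≠ u := fun h => far hy (h ▸ hvy)
      have ne : ∀ {y}, G.Adj v y → y ≠ u := fun h h' => far hv (h' ▸ h.symm)
      exact hu v y z hvu (ne hvy) (ne hvz) hvy hvz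
    · refine ⟨⟨Finset.subset_univ _, ?_⟩, Finset.mem_insert_self _ _⟩
      have far : ∀ {v}, v ∈ T → v ≠ u ∧ ¬ G.Adj u v ∧ ¬ G.Adj x v := fun hv => by
        obtain ⟨h1, h2⟩ := Finset.mem_filter.1 (hT hv)
        exact ⟨(mem_farSet.1 h1).1, (mem_farSet.1 h1).2, h2⟩
      rintro v hv y ⟨hvy, hy⟩ z ⟨hvz, hz⟩
      simp only [Finset.coe_insert, Set.mem_insert_iff, Finset.mem_coe] at hv hy hz
      rw [mem_neighborSet] at hvy hvz
      rcases hv with rfl | rfl | hv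
      · rcases hy with rfl | rfl | hy
        · exact absurd hvy G.irrefl
        · rcases hz with rfl | rfl | hz
          · exact absurd hvz G.irrefl
          · rfl
          · exact absurd hvz (far hz).2.1
        · exact absurd hvy (far hy).2.1
      · rcases hy with rfl | rfl | hy
        · rcases hz with rfl | rfl | hz
          · rfl
          · exact absurd hvz G.irrefl
          · exact absurd hvz (far hz).2.2
        · exact absurd hvy G.irrefl
        · exact absurd hvy (far hy).2.2
      · have ne : ∀ {y}, G.Adj v y → y ≠ u := fun h h' => (far hv).2.1 (h' ▸ h.symm)
        exact hu v y z (far hv).1 (ne hvy) (ne hvz) hvy hvz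

theorem card_dissocSetsThrough [DecidableEq V] (hu : IsHub G u) (hc : G.Connected) :
    (dissocSetsThrough G u Finset.univ).card =
      hubExcess (Fintype.card V) (farSet G u).card := by
  have : DecidableRel G.Adj := Classical.decRel _
  have huF : u ∉ farSet G u := fun h => (mem_farSet.1 h).1 rfl
  have hxF : ∀ {x}, x ∈ nearSet G u → x ∉ farSet G u := fun h h' =>
    (mem_farSet.1 h').2 (mem_nearSet.1 h)
  have huN : ∀ {x}, x ∈ nearSet G u → x ≠ u := fun h => (mem_nearSet.1 h).ne'
  rw [hu.dissocSetsThrough_univ, Finset.card_union_of_disjoint, Finset.card_biUnion]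
  · rw [Finset.card_image_of_injOn, Finset.card_powerset]
    · have hcard : ∀ x ∈ nearSet G u, (((farSet G u).filter fun y => ¬ G.Adj x y).powerset.image
          fun S => insert u (insert x S)).card =
          if x ∈ matchedSet G u then 2 ^ ((farSet G u).card - 1) else 2 ^ (farSet G u).card := by
        intro x hx
        rw [Finset.card_image_of_injOn, Finset.card_powerset]
        · split_ifs with hm
          · obtain ⟨-, y, hy, hxy⟩ := mem_matchedSet.1 hm
            rw [← Finset.card_erase_of_mem hy]
            congr 2
            ext z
            rw [Finset.mem_filter, Finset.mem_erase, and_comm, and_congr_left_iff]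
            intro hz
            refine ⟨fun h h' => h (h' ▸ hxy), fun h h' => h ?_⟩
            exact hu x z y (huN hx) (mem_farSet.1 hz).1 (mem_farSet.1 hy).1 h' hxy
          · congr 2
            rw [Finset.filter_true_of_mem]
            intro y hy hxy
            exact hm (mem_matchedSet.2 ⟨mem_nearSet.1 hx, y, hy, hxy⟩)
        · intro S hS T hT h
          simp only [Finset.coe_powerset, Set.mem_preimage, Set.mem_powerset_iff,
            Finset.coe_subset] at hS hT
          replace hS := hS.trans (Finset.filter_subset _ _)
          replace hT := hT.trans (Finset.filter_subset _ _)
          have e : ∀ {S}, S ⊆ farSet G u → ((insert u (insert x S)).erase u).erase x = S := by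
            intro S hS
            rw [Finset.erase_insert, Finset.erase_insert]
            · exact fun h => hxF hx (hS h)
            · rw [Finset.mem_insert, not_or]
              exact ⟨(huN hx).symm, fun h => huF (hS h)⟩
          rw [← e hS, ← e hT]
          exact congrArg (fun S => (S.erase u).erase x) h
      rw [Finset.sum_congr rfl hcard, Finset.sum_ite, Finset.sum_const, Finset.sum_const,
        smul_eq_mul, smul_eq_mul]
      have h1 : ((nearSet G u).filter fun x => x ∈ matchedSet G u) = matchedSet G u := by
        ext x
        rw [Finset.mem_filter, and_iff_right_iff_imp]
        exact fun h => mem_nearSet.2 (mem_matchedSet.1 h).1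
      have h2 := Finset.card_filter_add_card_filter_not (s := nearSet G u)
        (fun x => x ∈ matchedSet G u)
      rw [h1, hu.card_matchedSet hc] at h2
      have h3 := card_nearSet_add_card_farSet G u
      rw [h1, hu.card_matchedSet hc, hubExcess, ← add_assoc]
      congr 2
      omega
    · intro S hS T hT h
      simp only [Finset.coe_powerset, Set.mem_preimage, Set.mem_powerset_iff,
        Finset.coe_subset] at hS hT
      rw [← Finset.erase_insert (fun h => huF (hS h)), ← Finset.erase_insert (fun h => huF (hT h)),
        h]
  · intro x hx y hy hxy
    rw [Function.onFun, Finset.disjoint_left]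
    simp only [Finset.mem_image, Finset.mem_powerset, not_exists, not_and]
    rintro _ ⟨S, hS, rfl⟩ T hT h
    have : x ∈ insert u (insert y T) := by rw [h]; simp
    rcases Finset.mem_insert.1 this with h' | h'
    · exact huN hx h'
    · rcases Finset.mem_insert.1 h' with h' | h'
      · exact hxy h'
      · exact hxF hx (Finset.mem_filter.1 (hT h')).1
  · rw [Finset.disjoint_left]
    simp only [Finset.mem_image, Finset.mem_powerset, Finset.mem_biUnion, not_exists, not_and]
    rintro _ ⟨S, hS, rfl⟩ x hx T hT h
    have : x ∈ insert u S := by rw [← h]; simp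
    rcases Finset.mem_insert.1 this with h' | h'
    · exact huN hx h'
    · exact hxF hx (hS h')

theorem dissocNum_eq (hu : IsHub G u) (hc : G.Connected) :
    dissocNum G = 2 ^ (Fintype.card V - 1) + hubExcess (Fintype.card V) (farSet G u).card := by
  classical
  rw [dissocNum_eq_card, card_dissocSets G u, hu.dissocSets_univ_erase,
    hu.card_dissocSetsThrough hc, Finset.card_powerset,
    Finset.card_erase_of_mem (Finset.mem_univ u), Finset.card_univ]

theorem two_mul_card_farSet_add_one_le (hu : IsHub G u) (hc : G.Connected) :
    2 * (farSet G u).card + 1 ≤ Fintype.card V := by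
  classical
  have h1 := card_nearSet_add_card_farSet G u
  have h2 : (matchedSet G u).card ≤ (nearSet G u).card :=
    Finset.card_le_card fun x hx => mem_nearSet.2 (mem_matchedSet.1 hx).1
  rw [hu.card_matchedSet hc] at h2
  omega

end IsHub

end Hub

/-! ### Recognizing the extremal graphs -/

section Recognition

theorem exists_enum_of_count {V : Type*} [DecidableEq V] (s : List ℕ)
    (hs : ∀ a ∈ s, a ≤ 1) : ∀ R M : Finset V, Disjoint R M → s.count 0 = R.card →
    s.count 1 = M.card → ∃ g : Fin s.length → V, Function.Injective g ∧
      (∀ i, (s.get i = 0 ∧ g i ∈ R) ∨ (s.get i = 1 ∧ g i ∈ M)) ∧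
      ∀ x ∈ R ∪ M, ∃ i, g i = x := by
  induction s with
  | nil =>
    intro R M _ h0 h1
    rw [List.count_nil, eq_comm, Finset.card_eq_zero] at h0 h1
    subst h0 h1
    exact ⟨fun i => i.elim0, fun i => i.elim0, fun i => i.elim0, by simp⟩
  | cons a s ih =>
    intro R M hd h0 h1
    have ha : a = 0 ∨ a = 1 := by
      have := hs a (by simp)
      omega
    have hs' : ∀ a ∈ s, a ≤ 1 := fun a h => hs a (by simp [h])
    rcases ha with rfl | rfl
    · rw [List.count_cons_self] at h0
      rw [List.count_cons_of_ne (by simp)] at h1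
      obtain ⟨x, hx⟩ := Finset.card_pos.1 (by omega : 0 < R.card)
      obtain ⟨g, hg, h, hsurj⟩ := ih hs' (R.erase x) M
        (hd.mono_left (Finset.erase_subset _ _))
        (by rw [Finset.card_erase_of_mem hx]; omega) h1
      refine ⟨Fin.cons x g, Fin.cons_injective_iff.2 ⟨?_, hg⟩, ?_, ?_⟩
      · rintro ⟨i, rfl⟩
        rcases h i with h | h
        · exact (Finset.mem_erase.1 h.2).1 rfl
        · exact Finset.disjoint_left.1 hd hx h.2
      · refine Fin.cases (Or.inl ⟨rfl, hx⟩) fun i => ?_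
        exact (h i).imp_left fun h => ⟨h.1, Finset.mem_of_mem_erase h.2⟩
      · intro y hy
        by_cases hyx : y = x
        · exact ⟨0, hyx.symm⟩
        · obtain ⟨i, hi⟩ := hsurj y (by simpa [hyx] using hy)
          exact ⟨i.succ, hi⟩
    · rw [List.count_cons_self] at h1
      rw [List.count_cons_of_ne (by simp)] at h0
      obtain ⟨x, hx⟩ := Finset.card_pos.1 (by omega : 0 < M.card)
      obtain ⟨g, hg, h, hsurj⟩ := ih hs' R (M.erase x)
        (hd.mono_right (Finset.erase_subset _ _)) h0
        (by rw [Finset.card_erase_of_mem hx]; omega)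
      refine ⟨Fin.cons x g, Fin.cons_injective_iff.2 ⟨?_, hg⟩, ?_, ?_⟩
      · rintro ⟨i, rfl⟩
        rcases h i with h | h
        · exact Finset.disjoint_left.1 hd h.2 hx
        · exact (Finset.mem_erase.1 h.2).1 rfl
      · refine Fin.cases (Or.inr ⟨rfl, hx⟩) fun i => ?_
        exact (h i).imp_right fun h => ⟨h.1, Finset.mem_of_mem_erase h.2⟩
      · intro y hy
        by_cases hyx : y = x
        · exact ⟨0, hyx.symm⟩
        · obtain ⟨i, hi⟩ := hsurj y (by simpa [hyx] using hy)
          exact ⟨i.succ, hi⟩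

variable {r : ℕ} {s : List ℕ}

theorem starGraph_adj_inl_inl {a b : Fin (r + 1)} :
    (starGraph r s).Adj (Sum.inl a) (Sum.inl b) ↔ a ≠ b := by
  simp [_root_.starGraph]

theorem starGraph_adj_inl_inr {a : Fin (r + 1)} {i : Fin s.length} {l : Fin (s.get i + 1)} :
    (starGraph r s).Adj (Sum.inl a) (Sum.inr ⟨i, l⟩) ↔ a = 0 ∧ l = 0 := by
  constructor
  · rintro ⟨-, h | ⟨h, j, hj⟩ | ⟨h, -⟩⟩
    · cases h
    · cases hj
      exact ⟨Sum.inl_injective h, rfl⟩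
    · cases h
  · rintro ⟨rfl, rfl⟩
    exact ⟨Sum.inl_ne_inr, Or.inr (Or.inl ⟨rfl, i, rfl⟩)⟩

theorem starGraph_adj_inr_inr {i j : Fin s.length} {l : Fin (s.get i + 1)}
    {m : Fin (s.get j + 1)} :
    (starGraph r s).Adj (Sum.inr ⟨i, l⟩) (Sum.inr ⟨j, m⟩) ↔ i = j ∧ (l : ℕ) ≠ m := by
  constructor
  · rintro ⟨h0, h | ⟨h, -⟩ | ⟨h, -⟩⟩
    · obtain rfl : i = j := Option.some_injective _ h
      exact ⟨rfl, fun h => h0 (by rw [Fin.ext h])⟩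
    · cases h
    · cases h
  · rintro ⟨rfl, h⟩
    refine ⟨fun h' => h ?_, Or.inl rfl⟩
    cases h'
    rfl

variable {V : Type*} [Fintype V] {G : SimpleGraph V} {u : V}

namespace IsHub

theorem nonempty_iso_starGraph (hu : IsHub G u) (hc : G.Connected) {h : Fin (r + 1) → V}
    (hinj : Function.Injective h) (h0 : h 0 = u) (hcl : ∀ i j, i ≠ j → G.Adj (h i) (h j))
    (hm : ∀ j, h j ∉ matchedSet G u)
    (hR : ∀ x, G.Adj u x → x ∉ matchedSet G u → x ∉ Set.range h → ∀ y, y ≠ u → ¬ G.Adj x y)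
    (hs : ∀ a ∈ s, a ≤ 1) (hs0 : s.count 0 + (farSet G u).card + r = (nearSet G u).card)
    (hs1 : s.count 1 = (farSet G u).card) : Nonempty (G ≃g starGraph r s) := by
  classical
  have hnear : ∀ j, j ≠ 0 → G.Adj u (h j) := fun j hj => h0 ▸ hcl 0 j hj.symm
  have hMN : matchedSet G u ⊆ nearSet G u := Finset.filter_subset _ _
  have hCN : Finset.univ.image (h ∘ @Fin.succ r) ⊆ nearSet G u \ matchedSet G u := by
    intro x hx
    simp only [Finset.mem_image, Finset.mem_univ, true_and] at hx
    obtain ⟨j, rfl⟩ := hx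
    exact Finset.mem_sdiff.2 ⟨mem_nearSet.2 (hnear _ (Fin.succ_ne_zero j)), hm _⟩
  set R := (nearSet G u \ matchedSet G u) \ Finset.univ.image (h ∘ @Fin.succ r)
    with hRdef
  have hRcard : s.count 0 = R.card := by
    rw [hRdef, Finset.card_sdiff_of_subset hCN, Finset.card_sdiff_of_subset hMN,
      hu.card_matchedSet hc, Finset.card_image_of_injective _
        (hinj.comp (Fin.succ_injective r)), Finset.card_univ, Fintype.card_fin]
    omega
  have mem_R : ∀ {x}, x ∈ R ↔ G.Adj u x ∧ x ∉ matchedSet G u ∧ x ∉ Set.range h := by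
    intro x
    simp only [hRdef, Finset.mem_sdiff, mem_nearSet, Finset.mem_image, Finset.mem_univ, true_and,
      and_assoc, and_congr_right_iff]
    intro hux _
    refine not_congr ⟨fun ⟨j, hj⟩ => ⟨_, hj⟩, ?_⟩
    rintro ⟨j, rfl⟩
    obtain rfl | ⟨j, rfl⟩ := j.eq_zero_or_eq_succ
    · exact absurd hux (by rw [h0]; exact G.irrefl)
    · exact ⟨j, rfl⟩
  obtain ⟨g, hg, hgs, hsurj⟩ := exists_enum_of_count s hs R (matchedSet G u)
    (Finset.disjoint_left.2 fun x hx => (mem_R.1 hx).2.1) hRcard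
    (hs1.trans (hu.card_matchedSet hc).symm)
  have hp : ∀ x, ∃ y, x ∈ matchedSet G u → y ∈ farSet G u ∧ G.Adj x y := by
    intro x
    by_cases hx : x ∈ matchedSet G u
    · obtain ⟨-, y, hy⟩ := mem_matchedSet.1 hx
      exact ⟨y, fun _ => hy⟩
    · exact ⟨x, fun h => absurd h hx⟩
  choose m hmfar using hp
  have far_ne : ∀ {y}, y ∈ farSet G u → y ≠ u := fun hy => (mem_farSet.1 hy).1
  have far_not : ∀ {y}, y ∈ farSet G u → ¬ G.Adj u y := fun hy => (mem_farSet.1 hy).2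
  have gnear : ∀ i, G.Adj u (g i) := fun i => by
    rcases hgs i with h | h
    · exact (mem_R.1 h.2).1
    · exact (mem_matchedSet.1 h.2).1
  have gmatched : ∀ {i : Fin s.length} {l : Fin (s.get i + 1)}, l ≠ 0 →
      g i ∈ matchedSet G u := by
    intro i l hl
    rcases hgs i with h | h
    · exact absurd (Fin.ext (by have := l.2; simp only [Fin.val_zero]; omega)) hl
    · exact h.2
  have hh : ∀ j, h j ∉ farSet G u := by
    intro j hj
    by_cases hj0 : j = 0
    · exact far_ne hj (hj0 ▸ h0)
    · exact far_not hj (hnear j hj0)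
  have hhg : ∀ i j, h j ≠ g i := by
    intro i j hij
    rcases hgs i with h | h
    · exact (mem_R.1 h.2).2.2 ⟨j, hij⟩
    · exact hm j (hij ▸ h.2)
  have gnadj : ∀ i {y}, y ≠ u → y ∉ farSet G u → ¬ G.Adj (g i) y := by
    intro i y hyu hyf hadj
    rcases hgs i with h | h
    · obtain ⟨h1, h2, h3⟩ := mem_R.1 h.2
      exact hR _ h1 h2 h3 y hyu hadj
    · obtain ⟨h1, h2⟩ := hmfar _ h.2
      exact hyf (hu _ _ _ (gnear i).ne' hyu (far_ne h1) hadj h2 ▸ h1)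
  let φ : Fin (r + 1) ⊕ (Σ i : Fin s.length, Fin (s.get i + 1)) → V :=
    Sum.elim h fun p => if p.2 = 0 then g p.1 else m (g p.1)
  have φl : ∀ a, φ (Sum.inl a) = h a := fun a => rfl
  have φ0 : ∀ i, φ (Sum.inr ⟨i, 0⟩) = g i := fun i => by simp [φ]
  have φ1 : ∀ i (l : Fin (s.get i + 1)), l ≠ 0 → φ (Sum.inr ⟨i, l⟩) = m (g i) :=
    fun i l hl => if_neg hl
  have val_one : ∀ {i : Fin s.length} {l : Fin (s.get i + 1)}, l ≠ 0 → (l : ℕ) = 1 := by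
    intro i l hl
    have h1 : (l : ℕ) ≠ 0 := fun h => hl (Fin.ext h)
    have h2 := hs _ (s.get_mem i)
    omega
  have mg_inj : ∀ {i j}, g i ∈ matchedSet G u → g j ∈ matchedSet G u → G.Adj (g i) (m (g j)) →
      i = j := by
    intro i j hi hj h
    obtain ⟨h1, h2⟩ := hmfar _ hj
    exact hg (hu _ _ _ (far_ne h1) (gnear i).ne' (gnear j).ne' h.symm h2.symm)
  have hφi : Function.Injective φ := by
    have key : ∀ a i l, φ (Sum.inl a) ≠ φ (Sum.inr ⟨i, l⟩) := by
      intro a i l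
      by_cases hl : l = 0
      · subst hl
        rw [φ0]
        exact hhg i a
      · rw [φ1 i l hl, φl]
        exact fun h => hh a (h ▸ (hmfar _ (gmatched hl)).1)
    have key2 : ∀ i j (l : Fin (s.get j + 1)), l ≠ 0 → g i ≠ m (g j) := fun i j l hl h =>
      far_not (hmfar _ (gmatched hl)).1 (h ▸ gnear i)
    rintro (a | ⟨i, l⟩) (b | ⟨j, l'⟩) hab
    · rw [hinj hab]
    · exact absurd hab (key _ _ _)
    · exact absurd hab.symm (key _ _ _)
    · by_cases hl : l = 0 <;> by_cases hl' : l' = 0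
      · subst hl hl'
        rw [φ0, φ0] at hab
        rw [hg hab]
      · subst hl
        rw [φ0, φ1 _ _ hl'] at hab
        exact absurd hab (key2 _ _ _ hl')
      · subst hl'
        rw [φ0, φ1 _ _ hl] at hab
        exact absurd hab.symm (key2 _ _ _ hl)
      · rw [φ1 _ _ hl, φ1 _ _ hl'] at hab
        obtain rfl := mg_inj (gmatched hl) (gmatched hl') (hab ▸ (hmfar _ (gmatched hl)).2)
        rw [Fin.ext ((val_one hl).trans (val_one hl').symm)]
  have hφs : Function.Surjective φ := by
    intro x
    by_cases hxf : x ∈ farSet G u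
    · obtain ⟨y, hy, hxy⟩ := hu.exists_adj_of_mem_farSet hc hxf
      obtain ⟨i, rfl⟩ := hsurj y (Finset.mem_union_right _ hy)
      have hi : s.get i = 1 := by
        rcases hgs i with h | h
        · exact absurd hy (mem_R.1 h.2).2.1
        · exact h.1
      refine ⟨Sum.inr ⟨i, ⟨1, by omega⟩⟩, ?_⟩
      rw [φ1 _ _ (by simp [Fin.ext_iff])]
      obtain ⟨h1, h2⟩ := hmfar _ hy
      exact hu _ _ _ (gnear i).ne' (far_ne h1) (far_ne hxf) h2 hxy.symm
    · by_cases hxr : x ∈ Set.range h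
      · obtain ⟨j, rfl⟩ := hxr
        exact ⟨Sum.inl j, rfl⟩
      · have hux : G.Adj u x := by
          by_contra hux
          exact hxf (mem_farSet.2 ⟨fun hxu => hxr ⟨0, h0.trans hxu.symm⟩, hux⟩)
        obtain ⟨i, rfl⟩ := hsurj x (by
          rw [Finset.mem_union, mem_R]
          tauto)
        exact ⟨Sum.inr ⟨i, 0⟩, φ0 i⟩
  have adj_l : ∀ a i l, G.Adj (φ (Sum.inl a)) (φ (Sum.inr ⟨i, l⟩)) ↔
      (starGraph r s).Adj (Sum.inl a) (Sum.inr ⟨i, l⟩) := by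
    intro a i l
    rw [starGraph_adj_inl_inr, φl]
    by_cases hl : l = 0
    · subst hl
      rw [φ0]
      refine ⟨fun h => ⟨?_, rfl⟩, ?_⟩
      · by_contra ha
        exact gnadj i (hnear a ha).ne' (hh a) h.symm
      · rintro ⟨rfl, -⟩
        exact h0 ▸ gnear i
    · rw [φ1 _ _ hl]
      obtain ⟨h1, -⟩ := hmfar _ (gmatched hl)
      refine ⟨fun h => ?_, fun h => absurd h.2 hl⟩
      exfalso
      by_cases ha : a = 0
      · rw [ha, h0] at h
        exact far_not h1 h
      · exact hm a (mem_matchedSet.2 ⟨hnear a ha, _, h1, h⟩)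
  have adj_0 : ∀ i j (l : Fin (s.get j + 1)), G.Adj (φ (Sum.inr ⟨i, 0⟩)) (φ (Sum.inr ⟨j, l⟩)) ↔
      (starGraph r s).Adj (Sum.inr ⟨i, 0⟩) (Sum.inr ⟨j, l⟩) := by
    intro i j l
    rw [starGraph_adj_inr_inr, φ0]
    by_cases hl : l = 0
    · subst hl
      rw [φ0]
      refine ⟨fun h => ?_, fun h => absurd rfl h.2⟩
      exact absurd h (gnadj i (gnear j).ne' fun h' => far_not h' (gnear j))
    · rw [φ1 _ _ hl]
      obtain ⟨h1, h2⟩ := hmfar _ (gmatched hl)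
      refine ⟨fun h => ⟨?_, ?_⟩, ?_⟩
      · exact mg_inj (mem_matchedSet.2 ⟨gnear i, _, h1, h⟩) (gmatched hl) h
      · rw [val_one hl]
        simp
      · rintro ⟨rfl, -⟩
        exact h2
  refine ⟨RelIso.symm ⟨Equiv.ofBijective φ ⟨hφi, hφs⟩, fun {x y} => ?_⟩⟩
  suffices adj : ∀ x y, G.Adj (φ x) (φ y) ↔ (_root_.starGraph r s).Adj x y from adj x y
  rintro (a | ⟨i, l⟩) (b | ⟨j, l'⟩)
  · rw [starGraph_adj_inl_inl]
    exact ⟨fun hab h' => hab.ne (congrArg h h'), hcl a b⟩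
  · exact adj_l a j l'
  · rw [G.adj_comm, (_root_.starGraph r s).adj_comm]
    exact adj_l b i l
  · by_cases hl : l = 0
    · subst hl
      exact adj_0 i j l'
    by_cases hl' : l' = 0
    · subst hl'
      rw [G.adj_comm, (_root_.starGraph r s).adj_comm]
      exact adj_0 j i l
    rw [starGraph_adj_inr_inr, val_one hl, val_one hl']
    refine ⟨fun h => ?_, fun h => absurd rfl h.2⟩
    exfalso
    rw [φ1 _ _ hl, φ1 _ _ hl'] at h
    obtain ⟨h1, h2⟩ := hmfar _ (gmatched hl)
    obtain ⟨h3, h4⟩ := hmfar _ (gmatched hl')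
    exact far_not h3 (hu _ _ _ (far_ne h1) (far_ne h3) (gnear i).ne' h h2.symm ▸ gnear i)

end IsHub

theorem exists_isHub_of_iso (e : G ≃g starGraph r s) (hr : r ≤ 2)
    (hs : ∀ a ∈ s, a ≤ 1) : ∃ u, IsHub G u ∧ (nearSet G u).card = r + s.length := by
  classical
  refine ⟨e.symm (Sum.inl 0), ?_, ?_⟩
  · have key : ∀ x y z : Fin (r + 1) ⊕ (Σ i : Fin s.length, Fin (s.get i + 1)),
        x ≠ Sum.inl 0 → y ≠ Sum.inl 0 → z ≠ Sum.inl 0 → (starGraph r s).Adj x y →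
        (starGraph r s).Adj x z → y = z := by
      have hl : ∀ a i (l : Fin (s.get i + 1)), (Sum.inl a : Fin (r + 1) ⊕ (Σ i : Fin s.length,
          Fin (s.get i + 1))) ≠ Sum.inl 0 → ¬ (starGraph r s).Adj (Sum.inl a)
          (Sum.inr ⟨i, l⟩) := fun a i l ha h => ha (by rw [(starGraph_adj_inl_inr.1 h).1])
      rintro (a | ⟨i, l⟩) (b | ⟨j, m⟩) (c | ⟨k, p⟩) hx hy hz hxy hxz
      · rw [starGraph_adj_inl_inl] at hxy hxz
        simp only [ne_eq, Sum.inl.injEq, Fin.ext_iff, Fin.val_zero] at hx hy hz hxy hxz ⊢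
        omega
      · exact absurd hxz (hl _ _ _ hx)
      · exact absurd hxy (hl _ _ _ hx)
      · exact absurd hxz (hl _ _ _ hx)
      · exact absurd hxy.symm (hl _ _ _ hy)
      · exact absurd hxy.symm (hl _ _ _ hy)
      · exact absurd hxz.symm (hl _ _ _ hz)
      · rw [starGraph_adj_inr_inr] at hxy hxz
        obtain ⟨rfl, h1⟩ := hxy
        obtain ⟨rfl, h2⟩ := hxz
        have := hs _ (s.get_mem i)
        rw [show m = p from Fin.ext (by omega)]
    intro x y z hx hy hz hxy hxz
    refine e.injective (key (e x) (e y) (e z) ?_ ?_ ?_ (e.map_adj_iff.2 hxy)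
      (e.map_adj_iff.2 hxz))
    · exact fun h => hx (by rw [← h, e.symm_apply_apply])
    · exact fun h => hy (by rw [← h, e.symm_apply_apply])
    · exact fun h => hz (by rw [← h, e.symm_apply_apply])
  · let ψ : Fin r ⊕ Fin s.length → Fin (r + 1) ⊕ (Σ i : Fin s.length, Fin (s.get i + 1)) :=
      Sum.map Fin.succ fun i => ⟨i, 0⟩
    have hψ : Function.Injective ψ :=
      Sum.map_injective.2 ⟨Fin.succ_injective r, fun i j h => congrArg Sigma.fst h⟩
    have himg : nearSet G (e.symm (Sum.inl 0)) = Finset.univ.image (e.symm ∘ ψ) := by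
      ext x
      obtain ⟨x, rfl⟩ := e.symm.surjective x
      rw [mem_nearSet, e.symm.map_adj_iff]
      simp only [Finset.mem_image, Finset.mem_univ, true_and,
        Function.comp_apply, EmbeddingLike.apply_eq_iff_eq]
      rcases x with a | ⟨i, l⟩
      · rw [starGraph_adj_inl_inl]
        constructor
        · intro h
          obtain ⟨j, rfl⟩ := Fin.exists_succ_eq.2 h.symm
          exact ⟨Sum.inl j, rfl⟩
        · rintro ⟨j | j, hj⟩
          · rw [← Sum.inl_injective hj]
            exact (Fin.succ_ne_zero j).symm
          · cases hj
      · rw [starGraph_adj_inl_inr]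
        constructor
        · rintro ⟨-, rfl⟩
          exact ⟨Sum.inr i, rfl⟩
        · rintro ⟨j | j, hj⟩
          · cases hj
          · cases hj
            exact ⟨rfl, rfl⟩
    rw [himg, Finset.card_image_of_injective _ (e.symm.injective.comp hψ), Finset.card_univ,
      Fintype.card_sum, Fintype.card_fin, Fintype.card_fin]

end Recognition
/-! ### Hubs and the extremal graphs -/

section Extremal

variable {V : Type*} [Fintype V] {G : SimpleGraph V} {u : V}

namespace IsHub

theorem mem_unmatched_of_adj (hu : IsHub G u) {x y : V} (hux : G.Adj u x)
    (hx : x ∉ matchedSet G u) (hyu : y ≠ u) (hxy : G.Adj x y) :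
    G.Adj u y ∧ y ∉ matchedSet G u := by
  refine ⟨?_, fun hy => ?_⟩
  · by_contra huy
    exact hx (mem_matchedSet.2 ⟨hux, y, mem_farSet.2 ⟨hyu, huy⟩, hxy⟩)
  · obtain ⟨-, z, hz, hyz⟩ := mem_matchedSet.1 hy
    obtain ⟨hzu, huz⟩ := mem_farSet.1 hz
    exact huz (hu y x z hyu hux.ne' hzu hxy.symm hyz ▸ hux)

theorem isFGraph (hu : IsHub G u) (hc : G.Connected)
    (hb : (farSet G u).card = (Fintype.card V - 1) / 2) : IsFGraph (Fintype.card V) G := by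
  classical
  have h1 := card_nearSet_add_card_farSet G u
  have h2 := hu.card_matchedSet hc
  have hMN : matchedSet G u ⊆ nearSet G u := Finset.filter_subset _ _
  have h3 := Finset.card_sdiff_of_subset hMN
  have hmu : u ∉ matchedSet G u := fun h => G.irrefl (mem_matchedSet.1 h).1
  unfold IsFGraph
  split_ifs with hodd
  · obtain ⟨k, hk⟩ := hodd
    have hall : ∀ x, G.Adj u x → x ∈ matchedSet G u := by
      rw [Finset.eq_of_subset_of_card_le hMN (by omega)]
      exact fun x => mem_nearSet.2
    refine hu.nonempty_iso_starGraph hc (h := fun _ => u)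
      (fun i j _ => Fin.subsingleton_one.elim i j) rfl
      (fun i j h => absurd (Fin.subsingleton_one.elim i j) h) (fun _ => hmu)
      (fun x hx hx' => absurd (hall x hx) hx') (fun a ha => (List.eq_of_mem_replicate ha).le) ?_ ?_
    · simp [List.count_replicate]
      omega
    · simp
      omega
  · rw [Nat.not_odd_iff_even] at hodd
    obtain ⟨k, hk⟩ := hodd
    obtain ⟨p, hp⟩ := Finset.card_eq_one.1 (by omega : (nearSet G u \ matchedSet G u).card = 1)
    have hp' : ∀ x, G.Adj u x ∧ x ∉ matchedSet G u ↔ x = p := by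
      intro x
      rw [← Finset.mem_singleton, ← hp, Finset.mem_sdiff, mem_nearSet]
    obtain ⟨hup, hpm⟩ := (hp' p).2 rfl
    refine hu.nonempty_iso_starGraph hc (h := ![u, p]) ?_ rfl ?_ ?_
      (fun x hx hx' hxr => absurd ⟨1, ((hp' x).1 ⟨hx, hx'⟩).symm⟩ hxr)
      (fun a ha => (List.eq_of_mem_replicate ha).le) ?_ ?_
    · intro i j
      fin_cases i <;> fin_cases j <;> simp [hup.ne, hup.ne']
    · intro i j
      fin_cases i <;> fin_cases j <;> simp [hup, hup.symm]
    · intro i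
      fin_cases i <;> simp [hmu, hpm]
    · simp [List.count_replicate]
      omega
    · simp
      omega

theorem isUGraph_or_isTGraph (hu : IsHub G u) (hc : G.Connected) (h9 : 9 ≤ Fintype.card V)
    (hb : (farSet G u).card = (Fintype.card V - 1) / 2 - 1) :
    IsUGraph (Fintype.card V) G ∨ IsTGraph (Fintype.card V) G := by
  classical
  have h1 := card_nearSet_add_card_farSet G u
  have h2 := hu.card_matchedSet hc
  have hMN : matchedSet G u ⊆ nearSet G u := Finset.filter_subset _ _
  have h3 := Finset.card_sdiff_of_subset hMN
  have hmu : u ∉ matchedSet G u := fun h => G.irrefl (mem_matchedSet.1 h).1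
  have hmem : ∀ x, x ∈ nearSet G u \ matchedSet G u ↔ G.Adj u x ∧ x ∉ matchedSet G u := by
    intro x
    rw [Finset.mem_sdiff, mem_nearSet]
  by_cases hpq : ∃ p q, G.Adj u p ∧ p ∉ matchedSet G u ∧ q ≠ u ∧ G.Adj p q
  · left
    obtain ⟨p, q, hup, hpm, hqu, hpq⟩ := hpq
    obtain ⟨huq, hqm⟩ := hu.mem_unmatched_of_adj hup hpm hqu hpq
    refine hu.nonempty_iso_starGraph hc (h := ![u, p, q]) ?_ rfl ?_ ?_ ?_ ?_ ?_ ?_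
    · intro i j
      fin_cases i <;> fin_cases j <;> simp [hup.ne, hup.ne', huq.ne, huq.ne', hpq.ne, hpq.ne']
    · intro i j
      fin_cases i <;> fin_cases j <;> simp [hup, hup.symm, huq, huq.symm, hpq, hpq.symm]
    · intro i
      fin_cases i <;> simp [hmu, hpm, hqm]
    · intro x hux hxm hxr y hyu hxy
      obtain ⟨huy, hym⟩ := hu.mem_unmatched_of_adj hux hxm hyu hxy
      have hxp : x ≠ p := fun h => hxr ⟨1, h.symm⟩
      have hxq : x ≠ q := fun h => hxr ⟨2, h.symm⟩
      have hyp : y ≠ p := fun h => hxq (hu p x q hup.ne' hux.ne' hqu (h ▸ hxy.symm) hpq)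
      have hyq : y ≠ q := fun h => hxp (hu q x p hqu hux.ne' hup.ne' (h ▸ hxy.symm) hpq.symm)
      have hsub : ({x, y, p, q} : Finset V) ⊆ nearSet G u \ matchedSet G u := by
        intro z hz
        simp only [Finset.mem_insert, Finset.mem_singleton] at hz
        rw [hmem]
        rcases hz with rfl | rfl | rfl | rfl
        exacts [⟨hux, hxm⟩, ⟨huy, hym⟩, ⟨hup, hpm⟩, ⟨huq, hqm⟩]
      have h4 := Finset.card_le_card hsub
      rw [Finset.card_insert_of_notMem (by simp [hxy.ne, hxp, hxq]),
        Finset.card_insert_of_notMem (by simp [hyp, hyq]), Finset.card_pair hpq.ne] at h4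
      omega
    · intro a ha
      rcases List.mem_append.1 ha with ha | ha <;> rw [List.eq_of_mem_replicate ha]
      exact zero_le_one
    · simp [List.count_replicate]
      omega
    · simp [List.count_replicate]
      omega
  · right
    push Not at hpq
    have iso : ∀ k m, 2 * k + m + 1 = Fintype.card V → k = (farSet G u).card →
        Nonempty (G ≃g _root_.starGraph 0 (List.replicate m 0 ++ List.replicate k 1)) := by
      intro k m hk hkf
      refine hu.nonempty_iso_starGraph hc (h := fun _ => u)
        (fun i j _ => Fin.subsingleton_one.elim i j) rfl
        (fun i j h => absurd (Fin.subsingleton_one.elim i j) h) (fun _ => hmu)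
        (fun x hx hxm _ y hy => hpq x y hx hxm hy) ?_ ?_ ?_
      · intro a ha
        rcases List.mem_append.1 ha with ha | ha <;> rw [List.eq_of_mem_replicate ha]
        exact zero_le_one
      · simp [List.count_replicate]
        omega
      · simp [List.count_replicate]
        omega
    unfold IsTGraph
    split_ifs with hodd
    · obtain ⟨k, hk⟩ := hodd
      exact iso _ _ (by omega) (by omega)
    · rw [Nat.not_odd_iff_even] at hodd
      obtain ⟨k, hk⟩ := hodd
      exact iso _ _ (by omega) (by omega)

theorem dissocNum_eq_hBound (hu : IsHub G u) (hc : G.Connected) (h9 : 9 ≤ Fintype.card V)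
    (hb : (farSet G u).card = (Fintype.card V - 1) / 2 - 1) :
    dissocNum G = hBound (Fintype.card V) := by
  rw [hu.dissocNum_eq hc, hBound_eq h9, hb]

theorem dissocNum_lt_hBound (hu : IsHub G u) (hc : G.Connected) (h9 : 9 ≤ Fintype.card V)
    (hb : (farSet G u).card < (Fintype.card V - 1) / 2 - 1) :
    dissocNum G < hBound (Fintype.card V) := by
  rw [hu.dissocNum_eq hc, hBound_eq h9]
  exact Nat.add_lt_add_left ((hubExcess_lt_succ (by omega) (by omega)).trans_le
    (hubExcess_mono hb (by omega))) _

end IsHub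

theorem dissocNum_eq_hBound_of_iso (hc : G.Connected) (h9 : 9 ≤ Fintype.card V) {r : ℕ}
    {s : List ℕ} (e : Nonempty (G ≃g _root_.starGraph r s)) (hr : r ≤ 2) (hs : ∀ a ∈ s, a ≤ 1)
    (hl : r + s.length + ((Fintype.card V - 1) / 2 - 1) + 1 = Fintype.card V) :
    dissocNum G = hBound (Fintype.card V) := by
  classical
  obtain ⟨u, hu, hN⟩ := exists_isHub_of_iso e.some hr hs
  have := card_nearSet_add_card_farSet G u
  exact hu.dissocNum_eq_hBound hc h9 (by omega)

theorem dissocNum_eq_hBound_of_isUGraph_or_isTGraph (hc : G.Connected)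
    (h9 : 9 ≤ Fintype.card V)
    (h : IsUGraph (Fintype.card V) G ∨ IsTGraph (Fintype.card V) G) :
    dissocNum G = hBound (Fintype.card V) := by
  have hs : ∀ {i j k l : ℕ}, k ≤ 1 → l ≤ 1 →
      ∀ a ∈ List.replicate i k ++ List.replicate j l, a ≤ 1 := by
    intro i j k l hk hl a ha
    rcases List.mem_append.1 ha with ha | ha <;> rwa [List.eq_of_mem_replicate ha]
  rcases h with e | e
  · refine dissocNum_eq_hBound_of_iso hc h9 e le_rfl (hs le_rfl zero_le_one) ?_
    rw [List.length_append, List.length_replicate, List.length_replicate]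
    omega
  · unfold IsTGraph at e
    split_ifs at e with hodd
    · obtain ⟨k, hk⟩ := hodd
      refine dissocNum_eq_hBound_of_iso hc h9 e (Nat.zero_le 2) (hs zero_le_one le_rfl) ?_
      rw [List.length_append, List.length_replicate, List.length_replicate]
      omega
    · rw [Nat.not_odd_iff_even] at hodd
      obtain ⟨k, hk⟩ := hodd
      refine dissocNum_eq_hBound_of_iso hc h9 e (Nat.zero_le 2) (hs zero_le_one le_rfl) ?_
      rw [List.length_append, List.length_replicate, List.length_replicate]
      omega

theorem SimpleGraph.Connected.dissocNum_lt_hBound_or_exists_isHub (hc : G.Connected)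
    (h9 : 9 ≤ Fintype.card V) :
    dissocNum G < hBound (Fintype.card V) ∨ ∃ u, IsHub G u := by
  classical
  obtain ⟨v⟩ := hc.nonempty
  have split : HasSplit G Finset.univ → dissocNum G < hBound (Fintype.card V) := fun h => by
    rw [dissocNum_eq_card, ← Finset.card_univ]
    exact (h.card_dissocSets_le fun w Y hY _ => hY.card_dissocSets_le_maxDissoc).2
      (by rwa [Finset.card_univ])
  rcases (hc.rootedSpan_univ v).hasSplit_or_spider with h | ⟨u, h⟩
  · exact Or.inl (split h)
  · exact (h.hasSplit_or_isHub (by omega)).imp split fun h => ⟨u, h⟩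

end Extremal

/-- A connected graph of order `n ≥ 9` not isomorphic to `F_n` has at most `h(n)`
dissociation sets, with equality iff it is isomorphic to `U_n` or to `T_n`. -/
theorem connected_second_largest {V : Type*} [Fintype V] (G : SimpleGraph V) (n : ℕ)
    (hn : Fintype.card V = n) (h9 : 9 ≤ n) (hc : G.Connected) (hnF : ¬ IsFGraph n G) :
    dissocNum G ≤ hBound n ∧
      (dissocNum G = hBound n ↔ IsUGraph n G ∨ IsTGraph n G) := by
  subst hn
  have hconv := dissocNum_eq_hBound_of_isUGraph_or_isTGraph hc h9
  rcases hc.dissocNum_lt_hBound_or_exists_isHub h9 with h | ⟨u, hu⟩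
  · exact ⟨h.le, fun h' => absurd h' h.ne, hconv⟩
  have hb := hu.two_mul_card_farSet_add_one_le hc
  rcases lt_trichotomy (farSet G u).card ((Fintype.card V - 1) / 2 - 1) with h | h | h
  · have hlt := hu.dissocNum_lt_hBound hc h9 h
    exact ⟨hlt.le, fun h' => absurd h' hlt.ne, hconv⟩
  · exact ⟨(hu.dissocNum_eq_hBound hc h9 h).le, fun _ => hu.isUGraph_or_isTGraph hc h9 h, hconv⟩
  · exact absurd (hu.isFGraph hc (by omega)) hnF
end

section
/- For every n ≥ 3 with n ≠ 6, the graph U_n = K_3 ∗ (⌊(n−3)/2⌋ K_2 ∪ ((n+1) mod 2) K_1) contains no false twins: there are no two distinct vertices u, v of U_n with N(u) = N(v). -/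
open SimpleGraph

/-- If the hub clique has at least three vertices and at most one component is a single vertex,
then distinct vertices of `starGraph r s` have distinct open neighborhoods. -/
theorem starGraph_neighborSet_injective {r : ℕ} (hr : 2 ≤ r) (s : List ℕ)
    (hs : ∀ i j : Fin s.length, s.get i = 0 → s.get j = 0 → i = j) :
    Function.Injective (starGraph r s).neighborSet := by
  intro u v h
  by_contra huv
  have key : ∀ w, (starGraph r s).Adj u w ↔ (starGraph r s).Adj v w := fun w =>
    Set.ext_iff.1 h w
  have other : ∀ x : Fin (r + 1), ∃ y, y ≠ x ∧ y ≠ 0 := by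
    intro x
    by_cases hx : x = ⟨1, by omega⟩
    · exact ⟨⟨2, by omega⟩, by simp [hx], by simp [Fin.ext_iff]⟩
    · exact ⟨⟨1, by omega⟩, fun hy => hx hy.symm, by simp [Fin.ext_iff]⟩
  have single : ∀ (i j : Fin s.length) (a : Fin (s.get i + 1)) (b : Fin (s.get j + 1)), i ≠ j →
      (∀ w, (starGraph r s).Adj (Sum.inr ⟨i, a⟩) w → (starGraph r s).Adj (Sum.inr ⟨j, b⟩) w) →
      s.get i = 0 := by
    intro i j a b hij hsub
    by_contra hi
    have : Nontrivial (Fin (s.get i + 1)) := Fin.nontrivial_iff_two_le.2 (by omega)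
    obtain ⟨c, hc⟩ := exists_ne a
    have := hsub (Sum.inr ⟨i, c⟩) ⟨by simpa using hc.symm, Or.inl rfl⟩
    simp [_root_.starGraph, hij.symm] at this
  rcases u with x | ⟨i, a⟩ <;> rcases v with y | ⟨j, b⟩
  · exact ((key (Sum.inl y)).1 ⟨huv, Or.inl rfl⟩).1 rfl
  · obtain ⟨z, hzx, hz⟩ := other x
    have := (key (Sum.inl z)).1 ⟨by simpa using hzx.symm, Or.inl rfl⟩
    simp [_root_.starGraph, hz] at this
  · obtain ⟨z, hzy, hz⟩ := other y
    have := (key (Sum.inl z)).2 ⟨by simpa using hzy.symm, Or.inl rfl⟩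
    simp [_root_.starGraph, hz] at this
  · by_cases hij : i = j
    · subst hij
      exact ((key (Sum.inr ⟨i, b⟩)).1 ⟨huv, Or.inl rfl⟩).1 rfl
    · exact hij (hs i j (single i j a b hij fun w => (key w).1)
        (single j i b a (Ne.symm hij) fun w => (key w).2))

/-- For `n ≥ 3`, `n ≠ 6`, the graph `U_n = K₃ ∗ (⌊(n−3)/2⌋K₂ ∪ ((n+1) mod 2)K₁)`
has no false twins: no two distinct vertices have the same open neighborhood. -/
theorem Un_no_false_twins (n : ℕ) (h3 : 3 ≤ n) (h6 : n ≠ 6)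
    (u v : Fin 3 ⊕ (Σ i : Fin (List.replicate ((n - 3) / 2) 1 ++
        List.replicate ((n + 1) % 2) 0).length,
        Fin ((List.replicate ((n - 3) / 2) 1 ++ List.replicate ((n + 1) % 2) 0).get i + 1)))
    (huv : u ≠ v) :
    (starGraph 2 (List.replicate ((n - 3) / 2) 1 ++
        List.replicate ((n + 1) % 2) 0)).neighborSet u ≠
      (starGraph 2 (List.replicate ((n - 3) / 2) 1 ++
        List.replicate ((n + 1) % 2) 0)).neighborSet v := by
  refine fun h => huv (starGraph_neighborSet_injective le_rfl _ ?_ h)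
  rintro ⟨i, hi⟩ ⟨j, hj⟩ h0i h0j
  have hle : ∀ k (hk : k < (List.replicate ((n - 3) / 2) 1 ++
      List.replicate ((n + 1) % 2) 0).length),
      (List.replicate ((n - 3) / 2) 1 ++ List.replicate ((n + 1) % 2) 0)[k] = 0 →
      (n - 3) / 2 ≤ k := by
    intro k hk h0
    by_contra hlt
    rw [List.getElem_append_left (by simpa using hlt)] at h0
    simp at h0
  have := hle i hi h0i
  have := hle j hj h0j
  simp only [List.length_append, List.length_replicate] at hi hj
  simp only [Fin.mk.injEq]
  omega
end

section
/- Let P_n denote the path on n vertices. Then d(P_1) = 2, d(P_2) = 4, d(P_3) = 7, and for every n ≥ 4, d(P_n) = d(P_{n−1}) + d(P_{n−2}) + d(P_{n−3}). -/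
open SimpleGraph

/-- The subsets of `{0, …, n - 1}` that contain no three consecutive numbers. -/
def tripleFree (n : ℕ) : Finset (Finset ℕ) :=
  (Finset.range n).powerset.filter fun S => ∀ i ∈ S, ¬ (i + 1 ∈ S ∧ i + 2 ∈ S)

lemma mem_tripleFree {n : ℕ} {S : Finset ℕ} :
    S ∈ tripleFree n ↔ (∀ i ∈ S, i < n) ∧ ∀ i ∈ S, ¬ (i + 1 ∈ S ∧ i + 2 ∈ S) := by
  simp [tripleFree, Finset.subset_iff]

lemma isDissociation_pathGraph_iff {n : ℕ} {S : Finset ℕ} (hS : ∀ i ∈ S, i < n) :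
    IsDissociation (pathGraph n) {i : Fin n | (i : ℕ) ∈ S} ↔
      ∀ i ∈ S, ¬ (i + 1 ∈ S ∧ i + 2 ∈ S) := by
  constructor
  · rintro h i hi ⟨h1, h2⟩
    have := @h ⟨i + 1, hS _ h1⟩ h1 ⟨i, hS _ hi⟩ ⟨by simp [pathGraph_adj], hi⟩
      ⟨i + 2, hS _ h2⟩ ⟨by simp [pathGraph_adj], h2⟩
    simp at this
  · rintro h v hv a ⟨hva, ha⟩ b ⟨hvb, hb⟩
    simp only [mem_neighborSet, pathGraph_adj, Set.mem_ofPred_eq] at hv hva ha hvb hb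
    ext
    have h1 := h a ha
    have h2 := h b hb
    grind

lemma dissocNum_pathGraph_eq_card (n : ℕ) :
    dissocNum (pathGraph n) = (tripleFree n).card := by
  classical
  rw [dissocNum, ← Nat.card_eq_finsetCard]
  refine (Nat.card_eq_of_bijective (fun T : tripleFree n =>
    (⟨{i | (i : ℕ) ∈ T.1}, (isDissociation_pathGraph_iff (mem_tripleFree.1 T.2).1).2
      (mem_tripleFree.1 T.2).2⟩ : {S // IsDissociation (pathGraph n) S})) ⟨?_, ?_⟩).symm
  · rintro ⟨S, hS⟩ ⟨T, hT⟩ h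
    have hS := (mem_tripleFree.1 hS).1
    have hT := (mem_tripleFree.1 hT).1
    have h := Set.ext_iff.1 (congrArg Subtype.val h)
    ext x
    exact ⟨fun hx => (h ⟨x, hS x hx⟩).1 hx, fun hx => (h ⟨x, hT x hx⟩).2 hx⟩
  · rintro ⟨S, hS⟩
    set T : Finset ℕ := (Finset.univ.filter (· ∈ S)).map Fin.valEmbedding with hT
    have hTS : {i : Fin n | (i : ℕ) ∈ T} = S := by
      ext i
      simp [hT, Fin.val_inj]
    have hlt : ∀ i ∈ T, i < n := by
      simp only [hT, Finset.mem_map]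
      rintro _ ⟨i, -, rfl⟩
      exact i.2
    exact ⟨⟨T, mem_tripleFree.2 ⟨hlt, (isDissociation_pathGraph_iff hlt).1 (hTS ▸ hS)⟩⟩,
      Subtype.ext hTS⟩

lemma card_tripleFree_add_three (n : ℕ) :
    (tripleFree (n + 3)).card =
      (tripleFree (n + 2)).card + (tripleFree (n + 1)).card + (tripleFree n).card := by
  have key : tripleFree (n + 3) = (tripleFree (n + 2) ∪
      (tripleFree (n + 1)).image (insert (n + 2))) ∪
      (tripleFree n).image (fun S => insert (n + 2) (insert (n + 1) S)) := by
    ext S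
    simp only [Finset.mem_union, Finset.mem_image, mem_tripleFree]
    constructor
    · rintro ⟨hS, h⟩
      by_cases h2 : n + 2 ∈ S
      · by_cases h1 : n + 1 ∈ S
        · exact Or.inr ⟨(S.erase (n + 2)).erase (n + 1), by grind, by grind⟩
        · exact Or.inl (Or.inr ⟨S.erase (n + 2), by grind, by grind⟩)
      · exact Or.inl (Or.inl (by grind))
    · rintro ((h | ⟨T, h, rfl⟩) | ⟨T, h, rfl⟩)
      · grind
      · grind
      · grind
  have hinj1 : Set.InjOn (insert (n + 2)) (tripleFree (n + 1) : Set (Finset ℕ)) := by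
    intro S hS T hT hST
    have hS' := (mem_tripleFree.1 hS).1
    have hT' := (mem_tripleFree.1 hT).1
    ext x
    have := Finset.ext_iff.1 hST x
    grind
  have hinj2 : Set.InjOn (fun S => insert (n + 2) (insert (n + 1) S))
      (tripleFree n : Set (Finset ℕ)) := by
    intro S hS T hT hST
    have hS' := (mem_tripleFree.1 hS).1
    have hT' := (mem_tripleFree.1 hT).1
    ext x
    have := Finset.ext_iff.1 hST x
    grind
  rw [key, Finset.card_union_of_disjoint, Finset.card_union_of_disjoint,
    Finset.card_image_of_injOn hinj1, Finset.card_image_of_injOn hinj2]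
  · rw [Finset.disjoint_left]
    intro S hS hS'
    obtain ⟨T, hT, rfl⟩ := Finset.mem_image.1 hS'
    have := (mem_tripleFree.1 hS).1 (n + 2)
    grind
  · rw [Finset.disjoint_left]
    intro S hS hS'
    obtain ⟨T, hT, rfl⟩ := Finset.mem_image.1 hS'
    rcases Finset.mem_union.1 hS with hS | hS
    · have := (mem_tripleFree.1 hS).1 (n + 2)
      grind
    · obtain ⟨U, hU, hUT⟩ := Finset.mem_image.1 hS
      have := (mem_tripleFree.1 hU).1 (n + 1)
      have := Finset.ext_iff.1 hUT (n + 1)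
      grind

/-- `d(P₁) = 2`, `d(P₂) = 4`, `d(P₃) = 7`, and for `n ≥ 4`,
`d(Pₙ) = d(Pₙ₋₁) + d(Pₙ₋₂) + d(Pₙ₋₃)`. -/
theorem dissocNum_pathGraph :
    dissocNum (pathGraph 1) = 2 ∧ dissocNum (pathGraph 2) = 4 ∧
      dissocNum (pathGraph 3) = 7 ∧
      ∀ n : ℕ, 4 ≤ n →
        dissocNum (pathGraph n) =
          dissocNum (pathGraph (n - 1)) + dissocNum (pathGraph (n - 2)) +
            dissocNum (pathGraph (n - 3)) := by
  simp only [dissocNum_pathGraph_eq_card]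
  refine ⟨by decide, by decide, by decide, fun n hn => ?_⟩
  obtain ⟨m, rfl⟩ := Nat.exists_eq_add_of_le' (show 3 ≤ n by omega)
  exact card_tripleFree_add_three m
end

section
/- Let n ≥ 11 and let T be a tree of order n that attains the second-largest number of dissociation sets among all trees of order n (i.e., T maximizes d among all trees of order n that do not attain the maximum value of d over trees of order n). Let P = v_0 v_1 v_2 ⋯ v_l be a longest path in T, and let C be a connected component of T − v_2 with V(P) ∩ V(C) = ∅. Then C is either a single vertex or a single edge K_{1,1} (two vertices joined by an edge). -/
open SimpleGraph

/-- `T` attains the second-largest number of dissociation sets among all trees of order `n`: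
`T` is a tree of order `n` that does not attain the maximum of `d` over trees of order `n`,
and `d(T)` is largest among such trees. -/
def SecondLargestTree (n : ℕ) (T : SimpleGraph (Fin n)) : Prop :=
  T.IsTree ∧
  (∃ T' : SimpleGraph (Fin n), T'.IsTree ∧ dissocNum T < dissocNum T') ∧
  (∀ T' : SimpleGraph (Fin n), T'.IsTree →
    (∃ T'' : SimpleGraph (Fin n), T''.IsTree ∧ dissocNum T' < dissocNum T'') →
    dissocNum T' ≤ dissocNum T)

/-- For a rooted branch, the numbers of traces of dissociation sets that avoid the root, that
contain it but none of its children, and that contain it and one of its children. -/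
abbrev BranchCounts : Type := ℕ × ℕ × ℕ

/-- The counts of the branch obtained by making the root of the second branch a child of the root
of the first one. -/
def BranchCounts.join (c d : BranchCounts) : BranchCounts :=
  (c.1 * (d.1 + d.2.1 + d.2.2), c.2.1 * d.1, c.2.2 * d.1 + c.2.1 * d.2.1)

/-- The number of dissociation sets of the tree on `0, …, ps.length` given by the list `ps` of the
parents of the vertices `ps.length, …, 1`, when a branch with counts `w i` hangs at each `i`. -/
def treeCount : List ℕ → (ℕ → BranchCounts) → ℕ
  | [], w => (w 0).1 + (w 0).2.1 + (w 0).2.2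
  | p :: ps, w => treeCount ps (Function.update w p ((w p).join (w (ps.length + 1))))

/-- Every way of attaching at most `k` further leaves, one at a time, to the tree with parent list
`ps` eventually leads to at most half of all subsets being dissociation sets. -/
def halvedWithin : ℕ → List ℕ → Bool
  | 0, ps => decide (treeCount ps (fun _ => (1, 1, 0)) ≤ 2 ^ ps.length)
  | k + 1, ps => decide (treeCount ps (fun _ => (1, 1, 0)) ≤ 2 ^ ps.length) ||
      (List.range (ps.length + 1)).all fun p => halvedWithin k (p :: ps)

/-- The parent list of the tree made of a path `2 1 0 3 4` with middle vertex `0`, and a path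
`6 5 7` whose middle vertex `5` is joined to `0`. -/
def coreParents : List ℕ := [5, 5, 0, 3, 0, 1, 0]

theorem halvedWithin_coreParents : halvedWithin 3 coreParents = true := by
  decide +kernel

section Traces

variable {V : Type*} {G : SimpleGraph V}

/-- The traces on `B` of the dissociation sets of `G` that satisfy `P`. -/
def traces (G : SimpleGraph V) (P : Set V → Prop) (B : Set V) : Set (Set V) :=
  (· ∩ B) '' {S | IsDissociation G S ∧ P S}

theorem ncard_traces_union_le [Finite V] {P Q R : Set V → Prop} {B B' : Set V}
    (h : ∀ S, IsDissociation G S → P S → Q S ∧ R S) :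
    (traces G P (B ∪ B')).ncard ≤ (traces G Q B).ncard * (traces G R B').ncard := by
  rw [← Set.ncard_prod]
  refine (Set.ncard_le_ncard ?_ (Set.toFinite _)).trans
    (Set.ncard_image_le (f := fun A => A.1 ∪ A.2) (Set.toFinite _))
  rintro _ ⟨S, ⟨hS, hP⟩, rfl⟩
  exact ⟨(S ∩ B, S ∩ B'), ⟨⟨S, ⟨hS, (h S hS hP).1⟩, rfl⟩, ⟨S, ⟨hS, (h S hS hP).2⟩, rfl⟩⟩,
    (Set.inter_union_distrib_left ..).symm⟩

theorem ncard_traces_le_add [Finite V] {P Q R : Set V → Prop} {B : Set V}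
    (h : ∀ S, IsDissociation G S → P S → Q S ∨ R S) :
    (traces G P B).ncard ≤ (traces G Q B).ncard + (traces G R B).ncard := by
  refine (Set.ncard_le_ncard ?_ (Set.toFinite _)).trans (Set.ncard_union_le _ _)
  rintro _ ⟨S, ⟨hS, hP⟩, rfl⟩
  rcases h S hS hP with h | h
  · exact Or.inl ⟨S, ⟨hS, h⟩, rfl⟩
  · exact Or.inr ⟨S, ⟨hS, h⟩, rfl⟩

/-- The traces on `B` are bounded by the counts `c`, for the root `x` with set of children `N`. -/
structure IsBranch (G : SimpleGraph V) (x : V) (B N : Set V) (c : BranchCounts) : Prop where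
  children : N ⊆ G.neighborSet x
  out : (traces G (fun S => x ∉ S) B).ncard ≤ c.1
  free : (traces G (fun S => x ∈ S ∧ ∀ y ∈ N, y ∉ S) B).ncard ≤ c.2.1
  matched : (traces G (fun S => x ∈ S ∧ ∃ y ∈ N, y ∈ S) B).ncard ≤ c.2.2

theorem IsBranch.singleton (x : V) : IsBranch G x {x} ∅ (1, 1, 0) where
  children := Set.empty_subset _
  out := by
    refine (Set.ncard_le_ncard (t := {∅}) ?_).trans (Set.ncard_singleton _).le
    rintro _ ⟨S, ⟨-, hx⟩, rfl⟩
    exact Set.inter_singleton_eq_empty.2 hx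
  free := by
    refine (Set.ncard_le_ncard (t := {{x}}) ?_).trans (Set.ncard_singleton _).le
    rintro _ ⟨S, ⟨-, hx, -⟩, rfl⟩
    exact Set.inter_eq_right.2 (Set.singleton_subset_iff.2 hx)
  matched := by simp [traces]

theorem IsBranch.ncard_traces_le [Finite V] {x : V} {B N : Set V} {c : BranchCounts}
    (h : IsBranch G x B N c) :
    (traces G (fun _ => True) B).ncard ≤ c.1 + c.2.1 + c.2.2 := by
  have h1 : (traces G (fun _ => True) B).ncard ≤ _ + (traces G (fun S => x ∈ S) B).ncard :=
    ncard_traces_le_add (Q := fun S => x ∉ S) fun S _ _ => (em (x ∈ S)).symm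
  have h2 : (traces G (fun S => x ∈ S) B).ncard ≤ _ + _ :=
    ncard_traces_le_add (Q := fun S => x ∈ S ∧ ∀ y ∈ N, y ∉ S)
      (R := fun S => x ∈ S ∧ ∃ y ∈ N, y ∈ S) fun S _ hx => by
        by_cases hN : ∃ y ∈ N, y ∈ S
        · exact Or.inr ⟨hx, hN⟩
        · exact Or.inl ⟨hx, fun y hy hyS => hN ⟨y, hy, hyS⟩⟩
  have := h.out
  have := h.free
  have := h.matched
  omega

theorem IsBranch.join [Finite V] {x y : V} {B B' N N' : Set V} {c d : BranchCounts}
    (hx : IsBranch G x B N c) (hy : IsBranch G y B' N' d) (hxy : G.Adj x y)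
    (hyN : y ∉ N) (hxN : x ∉ N') : IsBranch G x (B ∪ B') (insert y N) (c.join d) where
  children := Set.insert_subset hxy hx.children
  out := (ncard_traces_union_le (Q := fun S => x ∉ S) (R := fun _ => True)
    fun S _ h => ⟨h, trivial⟩).trans (Nat.mul_le_mul hx.out hy.ncard_traces_le)
  free := (ncard_traces_union_le (Q := fun S => x ∈ S ∧ ∀ z ∈ N, z ∉ S) (R := fun S => y ∉ S)
    fun S _ h => ⟨⟨h.1, fun z hz => h.2 z (Set.mem_insert_of_mem y hz)⟩,
      h.2 y (Set.mem_insert y N)⟩).trans (Nat.mul_le_mul hx.free hy.out)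
  matched := by
    refine (ncard_traces_le_add (Q := fun S => (x ∈ S ∧ ∃ z ∈ N, z ∈ S) ∧ y ∉ S)
      (R := fun S => (x ∈ S ∧ ∀ z ∈ N, z ∉ S) ∧ y ∈ S ∧ ∀ z ∈ N', z ∉ S) ?_).trans
      (Nat.add_le_add
        ((ncard_traces_union_le fun S _ h => h).trans (Nat.mul_le_mul hx.matched hy.out))
        ((ncard_traces_union_le fun S _ h => h).trans (Nat.mul_le_mul hx.free hy.free)))
    rintro S hS ⟨hxS, z, hz, hzS⟩
    by_cases hyS : y ∈ S
    · refine Or.inr ⟨⟨hxS, fun t ht htS => ?_⟩, hyS, fun t ht htS => ?_⟩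
      · exact hyN (hS x hxS ⟨hxy, hyS⟩ ⟨hx.children ht, htS⟩ ▸ ht)
      · exact hxN (hS y hyS ⟨hxy.symm, hxS⟩ ⟨hy.children ht, htS⟩ ▸ ht)
    · rcases hz with rfl | hz
      · exact absurd hzS hyS
      · exact Or.inl ⟨⟨hxS, z, hz, hzS⟩, hyS⟩

theorem dissocNum_le_traces_mul [Finite V] (W : Set V) :
    dissocNum G ≤ (traces G (fun _ => True) W).ncard * 2 ^ (Nat.card V - W.ncard) := by
  have h1 : (traces G (fun _ => True) Wᶜ).ncard ≤ 2 ^ (Nat.card V - W.ncard) := by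
    rw [← Set.ncard_compl, ← Set.ncard_powerset]
    refine Set.ncard_le_ncard ?_ (Set.toFinite _)
    rintro _ ⟨S, -, rfl⟩
    exact Set.inter_subset_right
  have h2 : dissocNum G = (traces G (fun _ => True) (W ∪ Wᶜ)).ncard := by
    simp only [traces, Set.union_compl_self, Set.inter_univ, Set.image_id', and_true]
    rfl
  rw [h2]
  exact (ncard_traces_union_le fun _ _ _ => ⟨trivial, trivial⟩).trans
    (Nat.mul_le_mul_left _ h1)

end Traces

section ParentList

variable {V : Type*} {G : SimpleGraph V} {f : ℕ → V} {ps : List ℕ}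

/-- `f` maps the tree with parent list `ps` into `G`. -/
def MapsTree (G : SimpleGraph V) (f : ℕ → V) : List ℕ → Prop
  | [] => True
  | p :: ps => p < ps.length + 1 ∧ G.Adj (f p) (f (ps.length + 1)) ∧ MapsTree G f ps

theorem MapsTree.congr {g : ℕ → V} (h : MapsTree G f ps) (hfg : ∀ i < ps.length + 1, f i = g i) :
    MapsTree G g ps := by
  induction ps with
  | nil => trivial
  | cons p ps ih =>
    have hlen : (p :: ps).length = ps.length + 1 := rfl
    refine ⟨h.1, ?_, ih h.2.2 fun i hi => hfg i (by omega)⟩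
    have := h.1
    rw [← hfg p (by omega), ← hfg _ (by omega)]
    exact h.2.1

theorem MapsTree.ncard_traces_le [Finite V] (h : MapsTree G f ps)
    (hf : Set.InjOn f (Set.Iio (ps.length + 1))) {w : ℕ → BranchCounts} {B N : ℕ → Set V}
    (hw : ∀ i < ps.length + 1, IsBranch G (f i) (B i) (N i) (w i))
    (hN : ∀ i < ps.length + 1, ∀ j < ps.length + 1, f j ∉ N i) :
    (traces G (fun _ => True) (⋃ i ∈ Set.Iio (ps.length + 1), B i)).ncard ≤ treeCount ps w := by
  induction ps generalizing w B N with
  | nil =>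
    have : (⋃ i ∈ Set.Iio ([] : List ℕ).length.succ, B i) = B 0 := by simp
    rw [this]
    exact (hw 0 (by simp)).ncard_traces_le
  | cons p ps ih =>
    obtain ⟨hp, hadj, h⟩ := h
    set m := ps.length + 1 with hm
    have hlen : (p :: ps).length = m := rfl
    rw [hlen] at hf hw hN ⊢
    have hU : (⋃ i ∈ Set.Iio (m + 1), B i) =
        ⋃ i ∈ Set.Iio m, Function.update B p (B p ∪ B m) i := by
      ext x
      simp only [Set.mem_iUnion, Set.mem_Iio, exists_prop]
      constructor
      · rintro ⟨i, hi, hx⟩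
        rcases eq_or_ne i p with rfl | hip
        · exact ⟨i, hp, by simp [hx]⟩
        rcases Nat.lt_succ_iff_lt_or_eq.mp hi with hi | rfl
        · exact ⟨i, hi, by rwa [Function.update_of_ne hip]⟩
        · exact ⟨p, hp, by simp [hx]⟩
      · rintro ⟨i, hi, hx⟩
        rcases eq_or_ne i p with rfl | hip
        · rw [Function.update_self] at hx
          rcases hx with hx | hx
          · exact ⟨i, by omega, hx⟩
          · exact ⟨m, by omega, hx⟩
        · rw [Function.update_of_ne hip] at hx
          exact ⟨i, by omega, hx⟩
    rw [hU]
    refine ih h (hf.mono (Set.Iio_subset_Iio (by omega)))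
      (N := Function.update N p (insert (f m) (N p))) ?_ ?_
    · intro i hi
      rcases eq_or_ne i p with rfl | hip
      · simp only [Function.update_self]
        exact (hw i (by omega)).join (hw m (by omega)) hadj (hN _ (by omega) _ (by omega))
          (hN _ (by omega) _ (by omega))
      · simp only [Function.update_of_ne hip]
        exact hw i (by omega)
    · intro i hi j hj
      rcases eq_or_ne i p with rfl | hip
      · rw [Function.update_self, Set.mem_insert_iff, not_or]
        refine ⟨fun he => ?_, hN i (by omega) j (by omega)⟩
        have := hf (Set.mem_Iio.2 (by omega)) (Set.mem_Iio.2 (by omega)) he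
        omega
      · rw [Function.update_of_ne hip]
        exact hN i (by omega) j (by omega)

theorem MapsTree.dissocNum_le_of_treeCount_le [Finite V] (h : MapsTree G f ps)
    (hf : Set.InjOn f (Set.Iio (ps.length + 1)))
    (hc : treeCount ps (fun _ => (1, 1, 0)) ≤ 2 ^ ps.length) :
    dissocNum G ≤ 2 ^ (Nat.card V - 1) := by
  have h1 := h.ncard_traces_le hf (fun i _ => IsBranch.singleton (f i)) fun _ _ _ _ => id
  set W := ⋃ i ∈ Set.Iio (ps.length + 1), {f i} with hWdef
  have hW : W.ncard = ps.length + 1 := by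
    have : W = f '' Set.Iio (ps.length + 1) := by
      rw [hWdef, Set.image_eq_iUnion]
    rw [this, Set.InjOn.ncard_image hf, Set.ncard_eq_toFinset_card']
    simp
  have hle : W.ncard ≤ Nat.card V := Set.ncard_le_card W
  refine (dissocNum_le_traces_mul W).trans
    ((Nat.mul_le_mul_right _ (h1.trans hc)).trans (le_of_eq ?_))
  rw [← pow_add]
  congr 1
  omega

theorem MapsTree.dissocNum_le_of_halvedWithin [Finite V] (hG : G.Connected) (k : ℕ)
    (h : MapsTree G f ps) (hf : Set.InjOn f (Set.Iio (ps.length + 1)))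
    (hk : ps.length + 1 + k ≤ Nat.card V) (hps : halvedWithin k ps = true) :
    dissocNum G ≤ 2 ^ (Nat.card V - 1) := by
  induction k generalizing f ps with
  | zero => exact h.dissocNum_le_of_treeCount_le hf (by simpa [halvedWithin] using hps)
  | succ k ih =>
    simp only [halvedWithin, Bool.or_eq_true, decide_eq_true_eq, List.all_eq_true,
      List.mem_range] at hps
    rcases hps with hps | hps
    · exact h.dissocNum_le_of_treeCount_le hf hps
    set m := ps.length + 1 with hm
    obtain ⟨y, hy⟩ : ∃ y, y ∉ f '' Set.Iio m := by
      by_contra! h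
      have h1 : f '' Set.Iio m = Set.univ := Set.eq_univ_of_forall h
      have h2 := Set.ncard_image_le (f := f) (Set.finite_Iio m)
      rw [h1, Set.ncard_univ, Set.ncard_eq_toFinset_card'] at h2
      simp at h2
      omega
    obtain ⟨w⟩ := hG (f 0) y
    obtain ⟨d, -, ⟨p, hp, hpd⟩, hd⟩ := w.exists_boundary_dart (f '' Set.Iio m)
      ⟨0, Set.mem_Iio.2 (by omega), rfl⟩ hy
    have hp : p < m := hp
    have hag : ∀ i < m, f i = Function.update f m d.snd i := fun i hi => by
      rw [Function.update_of_ne (by omega)]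
    have hinj : Set.InjOn (Function.update f m d.snd) (Set.Iio (m + 1)) := by
      have hne : ∀ i < m, f i ≠ d.snd := fun i hi h => hd ⟨i, hi, h⟩
      intro i hi j hj hij
      simp only [Set.mem_Iio] at hi hj
      rcases Nat.lt_succ_iff_lt_or_eq.mp hi with hi | rfl <;>
        rcases Nat.lt_succ_iff_lt_or_eq.mp hj with hj | rfl
      · rw [← hag i hi, ← hag j hj] at hij
        exact hf hi hj hij
      · rw [← hag i hi, Function.update_self] at hij
        exact absurd hij (hne i hi)
      · rw [← hag j hj, Function.update_self] at hij
        exact absurd hij.symm (hne j hj)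
      · rfl
    have hmaps : MapsTree G (Function.update f m d.snd) (p :: ps) := by
      refine ⟨hp, ?_, h.congr hag⟩
      rw [← hag p hp, Function.update_self, hpd]
      exact d.adj
    have hlen : (p :: ps).length = m := rfl
    exact ih hmaps hinj (by omega) (hps p hp)

theorem exists_mapsTree_core {v₀ v₁ v₂ v₃ v₄ u w w' : V}
    (h : [v₂, v₁, v₀, v₃, v₄, u, w, w'].Nodup)
    (h21 : G.Adj v₂ v₁) (h10 : G.Adj v₁ v₀) (h23 : G.Adj v₂ v₃) (h34 : G.Adj v₃ v₄)
    (h2u : G.Adj v₂ u) (huw : G.Adj u w) (huw' : G.Adj u w') :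
    ∃ f : ℕ → V, Set.InjOn f (Set.Iio 8) ∧ MapsTree G f coreParents := by
  refine ⟨fun i => [v₂, v₁, v₀, v₃, v₄, u, w, w'].getD i v₂, fun i hi j hj hij => ?_,
    by simp [MapsTree, coreParents, *]⟩
  have hi : i < 8 := hi
  have hj : j < 8 := hj
  simp only at hij
  rw [List.getD_eq_getElem _ _ (by simpa using hi),
    List.getD_eq_getElem _ _ (by simpa using hj)] at hij
  exact (List.Nodup.getElem_inj_iff h).1 hij

end ParentList

section ParentGraph

variable {n : ℕ} [NeZero n]

/-- The graph in which every vertex `i ≠ 0` is joined to `f i`. -/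
def parentGraph (f : Fin n → Fin n) : SimpleGraph (Fin n) :=
  SimpleGraph.fromRel fun i j => i ≠ 0 ∧ f i = j

theorem parentGraph_isTree {f : Fin n → Fin n} (hf : ∀ i, i ≠ 0 → f i < i) :
    (parentGraph f).IsTree := by
  have hreach : ∀ i : Fin n, (parentGraph f).Reachable i 0 := by
    intro i
    induction i using WellFoundedLT.induction with
    | ind i ih =>
      by_cases hi : i = 0
      · rw [hi]
      · refine SimpleGraph.Reachable.trans (SimpleGraph.Adj.reachable ?_) (ih _ (hf i hi))
        exact ⟨(hf i hi).ne', Or.inl ⟨hi, rfl⟩⟩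
  have hconn : (parentGraph f).Connected :=
    { preconnected := fun i j => (hreach i).trans (hreach j).symm }
  refine SimpleGraph.isTree_iff_connected_and_card.2 ⟨hconn, le_antisymm ?_ ?_⟩
  · have hsub : (parentGraph f).edgeSet ⊆ (fun i => s(i, f i)) '' {i : Fin n | i ≠ 0} := by
      intro e
      induction e with
      | h x y =>
        rintro ⟨-, h | h⟩
        · exact ⟨x, h.1, by simp [h.2]⟩
        · exact ⟨y, h.1, by simp [h.2, Sym2.eq_swap]⟩
    have h1 := (Set.ncard_le_ncard hsub (Set.toFinite _)).trans
      (Set.ncard_image_le (Set.toFinite _))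
    have h2 : {i : Fin n | i ≠ 0}.ncard = n - 1 := by
      rw [show {i : Fin n | i ≠ 0} = {0}ᶜ from rfl, Set.ncard_compl]
      simp
    rw [Nat.card_coe_set_eq, Nat.card_eq_fintype_card, Fintype.card_fin]
    have := NeZero.pos n
    omega
  · exact hconn.card_vert_le_card_edgeSet_add_one

theorem two_pow_lt_dissocNum_star :
    2 ^ (n - 1) < dissocNum (parentGraph fun _ : Fin n => 0) := by
  let F : Option (Set {x : Fin n // x ≠ 0}) →
      {S : Set (Fin n) // IsDissociation (parentGraph fun _ : Fin n => 0) S} := fun o =>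
    match o with
    | none => ⟨{0}, fun _ _ x hx y hy => hx.2.trans hy.2.symm⟩
    | some A => ⟨Subtype.val '' A, by
        rintro _ ⟨v, -, rfl⟩ _ ⟨⟨-, h⟩, ⟨x, -, rfl⟩⟩
        rcases h with h | h
        · exact absurd h.2.symm x.2
        · exact absurd h.2.symm v.2⟩
  have hF : Function.Injective F := by
    rintro (_ | A) (_ | B) h
    · rfl
    · have h0 : (0 : Fin n) ∈ Subtype.val '' B := by
        have := Set.mem_singleton (0 : Fin n)
        rwa [show ({0} : Set (Fin n)) = Subtype.val '' B from Subtype.ext_iff.1 h] at this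
      obtain ⟨x, -, hx⟩ := h0
      exact absurd hx x.2
    · have h0 : (0 : Fin n) ∈ Subtype.val '' A := by
        have := Set.mem_singleton (0 : Fin n)
        rwa [show ({0} : Set (Fin n)) = Subtype.val '' A from (Subtype.ext_iff.1 h).symm] at this
      obtain ⟨x, -, hx⟩ := h0
      exact absurd hx x.2
    · exact congrArg some (Subtype.val_injective.image_injective (Subtype.ext_iff.1 h))
  have hcard := Nat.card_le_card_of_injective F hF
  rw [Nat.card_eq_fintype_card, Fintype.card_option, Fintype.card_set,
    Fintype.card_subtype_compl] at hcard
  rw [dissocNum]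
  simpa using hcard

theorem dissocNum_star_lt_dissocNum_broom (hn : 4 ≤ n) :
    dissocNum (parentGraph fun _ : Fin n => 0) <
      dissocNum (parentGraph fun i : Fin n => if i.val = 2 then ⟨1, by omega⟩ else 0) := by
  have hz : ((0 : Fin n) : ℕ) = 0 := rfl
  refine Set.ncard_lt_ncard (s := {S | IsDissociation _ S}) (t := {S | IsDissociation _ S})
    ⟨fun S hS v hv x hx y hy => ?_, fun h => ?_⟩ (Set.toFinite _)
  · have hS : IsDissociation _ S := hS
    by_cases h0 : (0 : Fin n) ∈ S
    · have heq : ∀ a ∈ S, ∀ b ∈ S, a ≠ 0 → b ≠ 0 → a = b := fun a ha b hb ha0 hb0 =>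
        hS 0 h0 ⟨⟨ha0.symm, Or.inr ⟨ha0, rfl⟩⟩, ha⟩ ⟨⟨hb0.symm, Or.inr ⟨hb0, rfl⟩⟩, hb⟩
      have hvx := hx.1.1
      have hvy := hy.1.1
      by_cases hx0 : x = 0 <;> by_cases hy0 : y = 0
      · rw [hx0, hy0]
      · exact absurd (heq v hv y hy.2 (hx0 ▸ hvx) hy0) hvy
      · exact absurd (heq v hv x hx.2 (hy0 ▸ hvy) hx0) hvx
      · exact heq x hx.2 y hy.2 hx0 hy0
    · have hne : ∀ a ∈ S, a ≠ 0 := fun a ha h => h0 (h ▸ ha)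
      have hv0 := hne v hv
      have hx0 := hne x hx.2
      have hy0 := hne y hy.2
      obtain ⟨⟨-, hx⟩, -⟩ := hx
      obtain ⟨⟨-, hy⟩, -⟩ := hy
      simp only at hx hy
      split_ifs at hx hy <;> simp only [Fin.ext_iff, ne_eq, hz] at * <;> omega
  · have hmem : ({0, ⟨2, by omega⟩, ⟨3, by omega⟩} : Set (Fin n)) ∈ {S | IsDissociation
        (parentGraph fun i : Fin n => if i.val = 2 then ⟨1, by omega⟩ else 0) S} := by
      intro v hv x hx y hy
      obtain ⟨⟨hvx, hx⟩, hxm⟩ := hx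
      obtain ⟨⟨hvy, hy⟩, hym⟩ := hy
      simp only [Set.mem_insert_iff, Set.mem_singleton_iff] at hv hxm hym
      simp only at hx hy
      split_ifs at hx hy <;> simp only [Fin.ext_iff, ne_eq, hz] at * <;> omega
    have hadj : ∀ i : Fin n, i ≠ 0 → (parentGraph fun _ : Fin n => 0).Adj 0 i := fun i hi =>
      ⟨hi.symm, Or.inr ⟨hi, rfl⟩⟩
    have hstar : (⟨2, by omega⟩ : Fin n) = ⟨3, by omega⟩ := h hmem 0 (by simp)
      ⟨hadj _ (by simp [Fin.ext_iff]), by simp⟩ ⟨hadj _ (by simp [Fin.ext_iff]), by simp⟩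
    simp at hstar

theorem SecondLargestTree.two_pow_lt_dissocNum {T : SimpleGraph (Fin n)}
    (hT : SecondLargestTree n T) (hn : 4 ≤ n) : 2 ^ (n - 1) < dissocNum T := by
  have hz : ((0 : Fin n) : ℕ) = 0 := rfl
  refine two_pow_lt_dissocNum_star.trans_le (hT.2.2 _ (parentGraph_isTree ?_)
    ⟨_, parentGraph_isTree ?_, dissocNum_star_lt_dissocNum_broom hn⟩)
  · exact fun i hi => Fin.pos_iff_ne_zero.2 hi
  · intro i hi
    simp only [Fin.ext_iff, ne_eq, hz] at hi
    split_ifs <;> simp only [Fin.lt_def, hz] <;> omega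

end ParentGraph

/-- If a component of `G - v₂`, where `v₂` is the third vertex of a longest path, avoids the path
and is neither a vertex nor an edge, then it contains a neighbor of `v₂` having two neighbors in
the component, and the path has length at least four. -/
theorem exists_core {V : Type*} [Finite V] {G : SimpleGraph V} (hG : G.Connected) {a b : V}
    (p : G.Walk a b) (hp : p.IsPath)
    (hlong : ∀ (c d : V) (q : G.Walk c d), q.IsPath → q.length ≤ p.length)
    {v : V} (hv : p.getVert 2 = v) (C : (G.induce ({v}ᶜ : Set V)).ConnectedComponent)
    (hdisj : ∀ x ∈ C.supp, (x : V) ∉ p.support)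
    (h1 : C.supp.ncard ≠ 1)
    (h2 : ¬ ∃ x y, x ≠ y ∧ C.supp = {x, y} ∧ (G.induce ({v}ᶜ : Set V)).Adj x y) :
    4 ≤ p.length ∧ ∃ u w w', u ∉ p.support ∧ w ∉ p.support ∧ w' ∉ p.support ∧ w ≠ w' ∧
      G.Adj v u ∧ G.Adj u w ∧ G.Adj u w' := by
  -- leaving `C` inside `G - v` is impossible
  have hclosed : ∀ x ∈ C.supp, ∀ y (hy : y ≠ v), G.Adj x y →
      (⟨y, hy⟩ : ({v}ᶜ : Set V)) ∈ C.supp := by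
    intro x hx y hy hxy
    have hxy' : (G.induce ({v}ᶜ : Set V)).Adj x ⟨y, hy⟩ := hxy
    exact (SimpleGraph.ConnectedComponent.mem_supp_congr_adj C hxy').1 hx
  obtain ⟨x₀, hx₀⟩ := C.nonempty_supp
  obtain ⟨u, hu, hvu⟩ : ∃ u ∈ C.supp, G.Adj v u := by
    obtain ⟨w⟩ := hG x₀ v
    obtain ⟨d, -, ⟨u, hu, hud⟩, hd⟩ := w.exists_boundary_dart (Subtype.val '' C.supp)
      ⟨x₀, hx₀, rfl⟩ (by rintro ⟨y, -, hy⟩; exact y.2 hy)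
    refine ⟨u, hu, ?_⟩
    have hdv : d.snd = v := by
      by_contra hne
      exact hd ⟨⟨d.snd, hne⟩, hclosed u hu _ hne (hud ▸ d.adj), rfl⟩
    rw [hud, ← hdv]
    exact d.adj.symm
  -- the boundary of a proper part of `C`
  have hbd : ∀ A : Set ({v}ᶜ : Set V), u ∈ A → A ⊂ C.supp →
      ∃ x ∈ A, ∃ y ∈ C.supp, y ∉ A ∧ G.Adj x y := by
    intro A huA hA
    obtain ⟨z, hz, hzA⟩ := Set.exists_of_ssubset hA
    obtain ⟨w⟩ := SimpleGraph.ConnectedComponent.exact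
      ((SimpleGraph.ConnectedComponent.mem_supp_iff C u).1 hu |>.trans
        ((SimpleGraph.ConnectedComponent.mem_supp_iff C z).1 hz).symm)
    obtain ⟨d, -, hd1, hd2⟩ := w.exists_boundary_dart A huA hzA
    exact ⟨d.fst, hd1, d.snd, hclosed _ (hA.1 hd1) _ d.snd.2 d.adj, hd2, d.adj⟩
  obtain ⟨w, hw, hwu, huw⟩ : ∃ w ∈ C.supp, w ≠ u ∧ G.Adj u w := by
    obtain ⟨x, rfl, y, hy, hyx, hxy⟩ := hbd {u} rfl
      ⟨by simpa using hu, fun h => h1 (Set.ncard_eq_one.2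
        ⟨u, h.antisymm (by simpa using hu)⟩)⟩
    exact ⟨y, hy, hyx, hxy⟩
  obtain ⟨x, hx, y, hy, hyA, hxy⟩ := hbd {u, w} (by simp)
    ⟨by rintro _ (rfl | rfl) <;> assumption, fun h => h2 ⟨u, w, hwu.symm,
      h.antisymm (by rintro _ (rfl | rfl) <;> assumption), huw⟩⟩
  simp only [Set.mem_insert_iff, Set.mem_singleton_iff, not_or] at hyA
  have hup := hdisj u hu
  have hwp := hdisj w hw
  have hyp := hdisj y hy
  have hvp : v ∈ p.support := hv ▸ p.getVert_mem_support 2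
  have hwu' : (w : V) ≠ u := fun h => hwu (Subtype.ext h)
  have hyu' : (y : V) ≠ u := fun h => hyA.1 (Subtype.ext h)
  have hyw' : (y : V) ≠ w := fun h => hyA.2 (Subtype.ext h)
  have h3 : 3 ≤ p.length := by
    by_contra! hlt
    have hvb : v = b := hv ▸ p.getVert_of_length_le (by omega)
    have hbu : G.Adj b u := hvb ▸ hvu
    have := hlong _ _ (p.concat hbu) (hp.concat hup _)
    rw [SimpleGraph.Walk.length_concat] at this
    omega
  obtain ⟨t, ht, htl, hts⟩ : ∃ t : G.Walk v a, t.IsPath ∧ t.length = 2 ∧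
      ∀ z, z ∉ p.support → z ∉ t.support := by
    subst hv
    refine ⟨(p.take 2).reverse, (hp.take 2).reverse, ?_, fun z hz h => hz ?_⟩
    · rw [SimpleGraph.Walk.length_reverse, SimpleGraph.Walk.take_length]
      omega
    · exact (p.isSubwalk_take 2).support_subset (by simpa using h)
  obtain ⟨r, hr, hrl, hrs⟩ : ∃ r : G.Walk v b, r.IsPath ∧ r.length = p.length - 2 ∧
      ∀ z, z ∉ p.support → z ∉ r.support := by
    subst hv
    exact ⟨p.drop 2, hp.drop 2, SimpleGraph.Walk.drop_length .., fun z hz h =>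
      hz ((p.isSubwalk_drop 2).support_subset h)⟩
  constructor
  · have hq : (SimpleGraph.Walk.cons huw.symm
        (SimpleGraph.Walk.cons hvu.symm t)).IsPath := by
      rw [SimpleGraph.Walk.cons_isPath_iff, SimpleGraph.Walk.cons_isPath_iff]
      refine ⟨⟨ht, hts _ hup⟩, ?_⟩
      rw [SimpleGraph.Walk.support_cons, List.mem_cons, not_or]
      exact ⟨hwu', hts _ hwp⟩
    have := hlong _ _ _ hq
    simp only [SimpleGraph.Walk.length_cons] at this
    omega
  · rcases hx with rfl | rfl
    · exact ⟨x, w, y, hup, hwp, hyp, hyw'.symm, hvu, huw, hxy⟩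
    · exfalso
      have hq : (SimpleGraph.Walk.cons hxy.symm (SimpleGraph.Walk.cons huw.symm
          (SimpleGraph.Walk.cons hvu.symm r))).IsPath := by
        rw [SimpleGraph.Walk.cons_isPath_iff, SimpleGraph.Walk.cons_isPath_iff,
          SimpleGraph.Walk.cons_isPath_iff]
        simp only [SimpleGraph.Walk.support_cons, List.mem_cons, not_or]
        exact ⟨⟨⟨hr, hrs _ hup⟩, hwu', hrs _ hwp⟩, hyw', hyu', hrs _ hyp⟩
      have := hlong _ _ _ hq
      simp only [SimpleGraph.Walk.length_cons] at this
      omega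

/-- For `n ≥ 11`, let `T` be a tree of order `n` with the second-largest number of
dissociation sets and `P = v₀v₁v₂⋯` a longest path of `T`. Every connected component
of `T − v₂` disjoint from `P` is a single vertex or a single edge. -/
theorem component_is_K1_or_K2 (n : ℕ) (h11 : 11 ≤ n)
    (T : SimpleGraph (Fin n)) (hT : SecondLargestTree n T)
    (a b : Fin n) (p : T.Walk a b) (hp : p.IsPath)
    (hlong : ∀ (c d : Fin n) (q : T.Walk c d), q.IsPath → q.length ≤ p.length)
    (C : (T.induce ({p.getVert 2}ᶜ : Set (Fin n))).ConnectedComponent)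
    (hdisj : ∀ x ∈ C.supp, (x : Fin n) ∉ p.support) :
    C.supp.ncard = 1 ∨
      ∃ x y, x ≠ y ∧ C.supp = {x, y} ∧
        (T.induce ({p.getVert 2}ᶜ : Set (Fin n))).Adj x y := by
  by_contra! hC
  have : NeZero n := ⟨by omega⟩
  obtain ⟨h4, u, w, w', hu, hw, hw', hne, h2u, huw, huw'⟩ :=
    exists_core hT.1.connected p hp hlong rfl C hdisj hC.1 (by
      rintro ⟨x, y, hxy, hs, hadj⟩
      exact hC.2 x y hxy hs hadj)
  have hadj : ∀ i < 4, T.Adj (p.getVert i) (p.getVert (i + 1)) := fun i hi =>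
    p.adj_getVert_succ (by omega)
  have hpne : ∀ i ≤ 4, ∀ j ≤ 4, i ≠ j → p.getVert i ≠ p.getVert j := fun i hi j hj hij h =>
    hij (hp.getVert_injOn (by simp; omega) (by simp; omega) h)
  have hoff : ∀ i, ∀ z ∉ p.support, p.getVert i ≠ z := fun i z hz h =>
    hz (h ▸ p.getVert_mem_support i)
  obtain ⟨f, hf, hmaps⟩ := exists_mapsTree_core (v₀ := p.getVert 0) (v₁ := p.getVert 1)
    (v₂ := p.getVert 2) (v₃ := p.getVert 3) (v₄ := p.getVert 4)
    (by simp [-SimpleGraph.Walk.getVert_zero, hpne, hoff, hu, hw, hw', hne, huw.ne, huw'.ne])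
    (hadj 1 (by norm_num)).symm (hadj 0 (by norm_num)).symm (hadj 2 (by norm_num))
    (hadj 3 (by norm_num)) h2u huw huw'
  have hle := hmaps.dissocNum_le_of_halvedWithin hT.1.connected 3 hf
    (by simpa [coreParents] using h11) halvedWithin_coreParents
  rw [Nat.card_eq_fintype_card, Fintype.card_fin] at hle
  exact absurd (hT.two_pow_lt_dissocNum (by omega)) (not_lt.2 hle)
end
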